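/- arXiv:2010.05381 — 3 statements merged into one kernel-verified Lean document; each statement's English description precedes it below -/
import Mathlib

section
/- Let H be a subgroup of a group G. Then the following are equivalent: (i) for every normal subgroup N of H there exists a normal subgroup M of G such that M ∩ H = N; (ii) for every subset S ⊆ H one has H ∩ ⟨⟨S⟩⟩_G = ⟨⟨S⟩⟩_H. -/
/-- **Reformulations of the congruence extension property.** For a subgroup `H ≤ G`,
the following are equivalent:
(i) every normal subgroup `N` of `H` is the intersection with `H` of some normal
subgroup `M` of `G`;
(ii) for every subset `S ⊆ H`, `H ∩ ⟨⟨S⟩⟩_G = ⟨⟨S⟩⟩_H` (as subgroups of `H`). -/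
theorem cep_iff_normal_closure_condition {G : Type*} [Group G] (H : Subgroup G) :
    (∀ N : Subgroup H, N.Normal →
        ∃ M : Subgroup G, M.Normal ∧ M.comap H.subtype = N) ↔
      (∀ S : Set H,
        (Subgroup.normalClosure (Subtype.val '' S)).comap H.subtype =
          Subgroup.normalClosure S) := by
  refine ⟨fun h S => le_antisymm ?_ ?_, fun h N hN => ?_⟩
  · obtain ⟨M, hM, hMN⟩ := h (Subgroup.normalClosure S) inferInstance
    have hS : Subtype.val '' S ⊆ (M : Set G) := by
      rintro _ ⟨x, hx, rfl⟩
      have hxM : x ∈ M.comap H.subtype := hMN ▸ Subgroup.subset_normalClosure hx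
      exact hxM
    exact (Subgroup.comap_mono (Subgroup.normalClosure_le_normal hS)).trans hMN.le
  · exact Subgroup.normalClosure_le_normal fun x hx =>
      Subgroup.subset_normalClosure (Set.mem_image_of_mem Subtype.val hx)
  · exact ⟨_, Subgroup.normalClosure_normal,
      (h N).trans (Subgroup.normalClosure_eq_self N)⟩
end

section
/- The Dehn function of a finitely presented group is well defined up to the equivalence ∼: if P = ⟨X ∣ R⟩ and Q = ⟨Y ∣ S⟩ are two finite presentations whose presented groups F(X)/⟨⟨R⟩⟩ and F(Y)/⟨⟨S⟩⟩ are isomorphic, then δ_P ∼ δ_Q. -/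
/-- The set of Burnside relators `{wⁿ : w ∈ F(A)}` in the free group on `A`. -/
def burnsideRels (A : Type) (n : ℕ) : Set (FreeGroup A) :=
  Set.range fun w : FreeGroup A => w ^ n

/-- The free Burnside group `B(A, n) = F(A)/⟨⟨{wⁿ : w ∈ F(A)}⟩⟩`. -/
abbrev Burnside (A : Type) (n : ℕ) : Type :=
  PresentedGroup (burnsideRels A n)

/-- The length `‖w‖` of the reduced word representing an element of a free group. -/
noncomputable def fgNorm {X : Type} (w : FreeGroup X) : ℕ :=
  letI := Classical.decEq X
  w.toWord.length

/-- `presArea R w` is the least `k` such that `w` can be written in `F(X)` as a product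
of `k` conjugates of elements of `R` or of their inverses. -/
noncomputable def presArea {X : Type} (R : Set (FreeGroup X)) (w : FreeGroup X) : ℕ :=
  sInf {k : ℕ | ∃ (f r : Fin k → FreeGroup X) (ε : Fin k → ℤ),
    (∀ i, r i ∈ R) ∧ (∀ i, ε i = 1 ∨ ε i = -1) ∧
    w = (List.ofFn fun i => f i * r i ^ ε i * (f i)⁻¹).prod}

/-- The Dehn function of the presentation `⟨X ∣ R⟩`:
`δ(L) = max { Area(w) : w ∈ ⟨⟨R⟩⟩, ‖w‖ ≤ L }`. -/
noncomputable def dehnFunction {X : Type} (R : Set (FreeGroup X)) (L : ℕ) : ℕ :=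
  sSup (presArea R '' {w : FreeGroup X | w ∈ Subgroup.normalClosure R ∧ fgNorm w ≤ L})

/-- `DominatedBy f g` means `f ≼ g`: there is `C ≥ 1` with
`f L ≤ C * g (C * L) + C * L + C` for all `L`. -/
def DominatedBy (f g : ℕ → ℕ) : Prop :=
  ∃ C : ℕ, 1 ≤ C ∧ ∀ L, f L ≤ C * g (C * L) + C * L + C

/-- `f ∼ g`: mutual domination. -/
def DehnEquivalent (f g : ℕ → ℕ) : Prop :=
  DominatedBy f g ∧ DominatedBy g f

/-- A presentation has quadratic Dehn function if its Dehn function is `∼`-equivalent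
to `L ↦ L²`. -/
def HasQuadraticDehnFunction {X : Type} (R : Set (FreeGroup X)) : Prop :=
  DehnEquivalent (dehnFunction R) (fun L => L ^ 2)

/-- `AreaLE R k w` means that `w` is a product of at most `k` conjugates of elements of `R` or of
their inverses. -/
def AreaLE {X : Type} (R : Set (FreeGroup X)) (k : ℕ) (w : FreeGroup X) : Prop :=
  ∃ l : List (FreeGroup X), (∀ g ∈ l, ∃ f, ∃ r ∈ R, ∃ ε : ℤ, (ε = 1 ∨ ε = -1) ∧
    g = f * r ^ ε * f⁻¹) ∧ l.length ≤ k ∧ w = l.prod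

namespace AreaLE

variable {X : Type} {R : Set (FreeGroup X)} {k m : ℕ} {v w : FreeGroup X}

theorem mono (h : AreaLE R k w) (hkm : k ≤ m) : AreaLE R m w := by
  obtain ⟨l, hl, hk, hw⟩ := h
  exact ⟨l, hl, hk.trans hkm, hw⟩

theorem one (R : Set (FreeGroup X)) (k : ℕ) : AreaLE R k 1 :=
  ⟨[], by simp, by simp, by simp⟩

theorem of_mem (h : w ∈ R) : AreaLE R 1 w :=
  ⟨[w], fun g hg => ⟨1, w, h, 1, Or.inl rfl, by simpa using hg⟩, by simp, by simp⟩

theorem mul (hv : AreaLE R k v) (hw : AreaLE R m w) : AreaLE R (k + m) (v * w) := by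
  obtain ⟨l, hl, hk, rfl⟩ := hv
  obtain ⟨l', hl', hm, rfl⟩ := hw
  refine ⟨l ++ l', fun g hg => ?_, by simp; omega, by simp⟩
  exact (List.mem_append.1 hg).elim (hl g) (hl' g)

theorem conj (hw : AreaLE R k w) (f : FreeGroup X) : AreaLE R k (f * w * f⁻¹) := by
  obtain ⟨l, hl, hk, rfl⟩ := hw
  refine ⟨l.map (MulAut.conj f), fun g hg => ?_, by simpa using hk, ?_⟩
  · obtain ⟨g', hg', rfl⟩ := List.mem_map.1 hg
    obtain ⟨f', r, hr, ε, hε, rfl⟩ := hl g' hg'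
    exact ⟨f * f', r, hr, ε, hε, by simp [mul_assoc]⟩
  · rw [← map_list_prod, MulAut.conj_apply]

theorem inv (hw : AreaLE R k w) : AreaLE R k w⁻¹ := by
  obtain ⟨l, hl, hk, rfl⟩ := hw
  refine ⟨(l.map Inv.inv).reverse, fun g hg => ?_, by simpa using hk, List.prod_inv_reverse l⟩
  obtain ⟨g', hg', rfl⟩ := List.mem_map.1 (List.mem_reverse.1 hg)
  obtain ⟨f, r, hr, ε, hε, rfl⟩ := hl g' hg'
  exact ⟨f, r, hr, -ε, by omega, by simp [mul_assoc]⟩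

theorem exists_ofFn_prod (h : AreaLE R k w) : ∃ j ≤ k,
    ∃ (f r : Fin j → FreeGroup X) (ε : Fin j → ℤ),
    (∀ i, r i ∈ R) ∧ (∀ i, ε i = 1 ∨ ε i = -1) ∧
    w = (List.ofFn fun i => f i * r i ^ ε i * (f i)⁻¹).prod := by
  obtain ⟨l, hl, hk, rfl⟩ := h
  choose f r hr ε hε hg using fun i : Fin l.length => hl (l.get i) (l.get_mem i)
  refine ⟨l.length, hk, f, r, ε, hr, hε, ?_⟩
  simp_rw [← hg]
  exact congrArg List.prod (List.ofFn_get l).symm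

theorem presArea_le (h : AreaLE R k w) : presArea R w ≤ k := by
  obtain ⟨j, hj, hw⟩ := h.exists_ofFn_prod
  exact (Nat.sInf_le hw).trans hj

theorem exists_of_mem_normalClosure (h : w ∈ Subgroup.normalClosure R) : ∃ k, AreaLE R k w := by
  let N : Subgroup (FreeGroup X) :=
    { carrier := {w | ∃ k, AreaLE R k w}
      one_mem' := ⟨0, one R 0⟩
      mul_mem' := fun ⟨_, ha⟩ ⟨_, hb⟩ => ⟨_, ha.mul hb⟩
      inv_mem' := fun ⟨k, ha⟩ => ⟨k, ha.inv⟩ }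
  have : N.Normal := ⟨fun _ ⟨k, ha⟩ g => ⟨k, ha.conj g⟩⟩
  exact Subgroup.normalClosure_le_normal (N := N) (fun _ hr => ⟨1, of_mem hr⟩) h

theorem of_presArea (h : w ∈ Subgroup.normalClosure R) : AreaLE R (presArea R w) w := by
  obtain ⟨k, hk⟩ := exists_of_mem_normalClosure h
  obtain ⟨j, -, hw⟩ := hk.exists_ofFn_prod
  have hmem : presArea R w ∈ {k : ℕ | ∃ (f r : Fin k → FreeGroup X) (ε : Fin k → ℤ),
      (∀ i, r i ∈ R) ∧ (∀ i, ε i = 1 ∨ ε i = -1) ∧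
      w = (List.ofFn fun i => f i * r i ^ ε i * (f i)⁻¹).prod} := Nat.sInf_mem ⟨j, hw⟩
  obtain ⟨f, r, ε, hr, hε, hw⟩ := hmem
  refine ⟨_, fun g hg => ?_, List.length_ofFn.le, hw⟩
  obtain ⟨i, rfl⟩ := List.mem_ofFn.1 hg
  exact ⟨f i, r i, hr i, ε i, hε i, rfl⟩

theorem map {Y : Type} {S : Set (FreeGroup Y)} {K : ℕ} (φ : FreeGroup X →* FreeGroup Y)
    (hφ : ∀ r ∈ R, AreaLE S K (φ r)) (hw : AreaLE R k w) : AreaLE S (K * k) (φ w) := by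
  obtain ⟨l, hl, hk, rfl⟩ := hw
  refine mono (k := K * l.length) ?_ (Nat.mul_le_mul_left K hk)
  clear hk
  induction l with
  | nil => simpa using one S 0
  | cons g l ih =>
    obtain ⟨f, r, hr, ε, hε, hg⟩ := hl g List.mem_cons_self
    have hφg : AreaLE S K (φ g) := by
      rcases hε with rfl | rfl
      · simpa [hg] using (hφ r hr).conj (φ f)
      · simpa [hg] using (hφ r hr).inv.conj (φ f)
    rw [List.prod_cons, map_mul, List.length_cons, Nat.mul_succ, Nat.add_comm]
    exact hφg.mul (ih fun g hg => hl g (List.mem_cons_of_mem _ hg))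

end AreaLE

theorem fgNorm_mul_le {X : Type} (v w : FreeGroup X) : fgNorm (v * w) ≤ fgNorm v + fgNorm w :=
  letI := Classical.decEq X
  FreeGroup.norm_mul_le v w

theorem exists_mk_eq_length_eq_fgNorm {X : Type} (w : FreeGroup X) :
    ∃ l : List (X × Bool), FreeGroup.mk l = w ∧ l.length = fgNorm w :=
  letI := Classical.decEq X
  ⟨w.toWord, FreeGroup.mk_toWord, rfl⟩

theorem finite_setOf_fgNorm_le (X : Type) [Finite X] (L : ℕ) :
    {w : FreeGroup X | fgNorm w ≤ L}.Finite := by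
  refine ((List.finite_length_le (X × Bool) L).image FreeGroup.mk).subset fun w hw => ?_
  obtain ⟨l, hl, hlen⟩ := exists_mk_eq_length_eq_fgNorm w
  exact ⟨l, hlen.trans_le hw, hl⟩

theorem presArea_le_dehnFunction {X : Type} [Finite X] {R : Set (FreeGroup X)} {w : FreeGroup X}
    {L : ℕ} (hw : w ∈ Subgroup.normalClosure R) (hL : fgNorm w ≤ L) :
    presArea R w ≤ dehnFunction R L :=
  le_csSup (((finite_setOf_fgNorm_le X L).subset fun _ h => h.2).image _).bddAbove
    ⟨w, ⟨hw, hL⟩, rfl⟩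

theorem exists_fgNorm_map_le {X Y : Type} [Finite X] (φ : FreeGroup X →* FreeGroup Y) :
    ∃ C, ∀ w, fgNorm (φ w) ≤ C * fgNorm w := by
  obtain ⟨C, hC⟩ := (Set.finite_range
    fun a : X × Bool => fgNorm (φ (FreeGroup.mk [a]))).bddAbove
  refine ⟨C, fun w => ?_⟩
  obtain ⟨l, rfl, hl⟩ := exists_mk_eq_length_eq_fgNorm w
  rw [← hl]
  clear hl
  induction l with
  | nil => simp [← FreeGroup.one_eq_mk, fgNorm]
  | cons a l ih =>
    rw [show FreeGroup.mk (a :: l) = FreeGroup.mk [a] * FreeGroup.mk l from rfl, map_mul,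
      List.length_cons, Nat.mul_succ, Nat.add_comm]
    exact (fgNorm_mul_le _ _).trans (Nat.add_le_add (hC ⟨a, rfl⟩) ih)

theorem exists_areaLE_map {X Y : Type} {R : Set (FreeGroup X)} {S : Set (FreeGroup Y)}
    (hR : R.Finite) (φ : FreeGroup X →* FreeGroup Y)
    (hφ : ∀ r ∈ R, φ r ∈ Subgroup.normalClosure S) :
    ∃ K, ∀ k w, AreaLE R k w → AreaLE S (K * k) (φ w) := by
  obtain ⟨K, hK⟩ := (hR.image fun r => presArea S (φ r)).bddAbove
  exact ⟨K, fun k w hw => hw.map φ fun r hr =>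
    (AreaLE.of_presArea (hφ r hr)).mono (hK ⟨r, hr, rfl⟩)⟩

/-- An endomorphism of the free group inducing the identity on the presented group moves each
word by an element of area linear in its length. -/
theorem exists_areaLE_mul_inv {X : Type} [Finite X] {R : Set (FreeGroup X)}
    (θ : FreeGroup X →* FreeGroup X) (hθ : ∀ w, w * (θ w)⁻¹ ∈ Subgroup.normalClosure R) :
    ∃ M, ∀ w, AreaLE R (M * fgNorm w) (w * (θ w)⁻¹) := by
  obtain ⟨M, hM⟩ := (Set.finite_range fun a : X × Bool =>
    presArea R (FreeGroup.mk [a] * (θ (FreeGroup.mk [a]))⁻¹)).bddAbove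
  refine ⟨M, fun w => ?_⟩
  obtain ⟨l, rfl, hl⟩ := exists_mk_eq_length_eq_fgNorm w
  rw [← hl]
  clear hl
  induction l with
  | nil => simpa [← FreeGroup.one_eq_mk] using AreaLE.one R 0
  | cons a l ih =>
    have ha := (AreaLE.of_presArea (hθ (FreeGroup.mk [a]))).mono (hM ⟨a, rfl⟩)
    have h := (ih.conj (FreeGroup.mk [a])).mul ha
    rw [show FreeGroup.mk (a :: l) = FreeGroup.mk [a] * FreeGroup.mk l from rfl, map_mul,
      List.length_cons, Nat.mul_succ]
    convert h using 1
    group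

theorem exists_lift_presentedGroup_hom {X Y : Type} {R : Set (FreeGroup X)}
    {S : Set (FreeGroup Y)} (f : PresentedGroup R →* PresentedGroup S) :
    ∃ φ : FreeGroup X →* FreeGroup Y,
      ∀ w, PresentedGroup.mk S (φ w) = f (PresentedGroup.mk R w) := by
  choose g hg using fun x => PresentedGroup.mk_surjective S (f (PresentedGroup.of x))
  refine ⟨FreeGroup.lift g, DFunLike.congr_fun
    (f := (PresentedGroup.mk S).comp (FreeGroup.lift g)) (g := f.comp (PresentedGroup.mk R)) ?_⟩
  ext x
  simpa only [MonoidHom.comp_apply, FreeGroup.lift_apply_of, PresentedGroup.of] using hg x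

theorem dehnFunction_dominatedBy {X Y : Type} [Finite X] [Finite Y] {R : Set (FreeGroup X)}
    {S : Set (FreeGroup Y)} (hS : S.Finite) (e : PresentedGroup R ≃* PresentedGroup S) :
    DominatedBy (dehnFunction R) (dehnFunction S) := by
  obtain ⟨φ, hφ⟩ := exists_lift_presentedGroup_hom e.toMonoidHom
  obtain ⟨ψ, hψ⟩ := exists_lift_presentedGroup_hom e.symm.toMonoidHom
  obtain ⟨C, hC⟩ := exists_fgNorm_map_le φ
  obtain ⟨K, hK⟩ := exists_areaLE_map (R := S) (S := R) hS ψ fun s hs => by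
    rw [← PresentedGroup.mk_eq_one_iff, hψ,
      PresentedGroup.mk_eq_one_iff.2 (Subgroup.subset_normalClosure hs), map_one]
  obtain ⟨M, hM⟩ := exists_areaLE_mul_inv (R := R) (ψ.comp φ) fun w => by
    rw [← PresentedGroup.mk_eq_one_iff]
    simp [hφ, hψ]
  refine ⟨C + K + M + 1, by omega, fun L => csSup_le' ?_⟩
  rintro _ ⟨w, ⟨hw, hL⟩, rfl⟩
  have hφw : φ w ∈ Subgroup.normalClosure S := by
    rw [← PresentedGroup.mk_eq_one_iff, hφ, PresentedGroup.mk_eq_one_iff.2 hw, map_one]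
  have harea := (hM w).mul (hK _ _ (AreaLE.of_presArea hφw))
  rw [MonoidHom.comp_apply, inv_mul_cancel_right] at harea
  have hnorm : fgNorm (φ w) ≤ (C + K + M + 1) * L :=
    (hC w).trans (Nat.mul_le_mul (by omega) hL)
  calc presArea R w ≤ M * fgNorm w + K * presArea S (φ w) := harea.presArea_le
    _ ≤ (C + K + M + 1) * L + (C + K + M + 1) * dehnFunction S ((C + K + M + 1) * L) :=
        Nat.add_le_add (Nat.mul_le_mul (by omega) hL)
          (Nat.mul_le_mul (by omega) (presArea_le_dehnFunction hφw hnorm))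
    _ ≤ _ := by omega

/-- **The Dehn function is well defined up to `∼`.** If two finite presentations
present isomorphic groups, then their Dehn functions are `∼`-equivalent. -/
theorem dehnFunction_well_defined {X Y : Type} [Fintype X] [Fintype Y]
    (R : Set (FreeGroup X)) (S : Set (FreeGroup Y)) (hR : R.Finite) (hS : S.Finite)
    (h : Nonempty (PresentedGroup R ≃* PresentedGroup S)) :
    DehnEquivalent (dehnFunction R) (dehnFunction S) := by
  obtain ⟨e⟩ := h
  exact ⟨dehnFunction_dominatedBy hS e, dehnFunction_dominatedBy hR e.symm⟩
end

section
/- Optimality of the examples: let P = ⟨X ∣ R⟩ be a finite presentation of a group G. If G contains a subgroup H that is finitely generated, infinite, and torsion (every element of H has finite order), then the Dehn function of P is at least quadratic: (L ↦ L²) ≼ δ_P. -/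
namespace DehnGap

section

open FreeGroup (mk invRev)

variable {α G : Type*} [Group G]

/-- `Fill π s k w`: the cyclic word `w` bounds a disc diagram with at most `k` cells, a cell being
any relation of `π` of length at most `s`.  The constructors describe what happens to the first
edge: it is glued to another boundary edge, or it lies on a cell. -/
inductive Fill (π : FreeGroup α →* G) (s : ℕ) : ℕ → List (α × Bool) → Prop
  | nil (k : ℕ) : Fill π s k []
  | pair {a b : ℕ} (e : α × Bool) {u v : List (α × Bool)} :
      Fill π s a u → Fill π s b v → Fill π s (a + b) (e :: (u ++ (e.1, !e.2) :: v))
  | cell {k : ℕ} (e : α × Bool) (r : List (α × Bool)) {v : List (α × Bool)} :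
      r.length < s → π (mk [e]) = π (mk r) → Fill π s k (r ++ v) → Fill π s (k + 1) (e :: v)

variable {π : FreeGroup α →* G} {s : ℕ}

namespace Fill

lemma succ {k : ℕ} {w : List (α × Bool)} (h : Fill π s k w) : Fill π s (k + 1) w := by
  induction h with
  | nil k => exact nil _
  | @pair a b e u v hu hv ihu ihv => exact Fill.pair (a := a) (b := b + 1) e hu ihv
  | cell e r hr he h ih => exact cell e r hr he ih

lemma mono {k l : ℕ} {w : List (α × Bool)} (h : Fill π s k w) (hkl : k ≤ l) : Fill π s l w := by
  induction hkl with
  | refl => exact h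
  | step _ ih => exact ih.succ

lemma append {a b : ℕ} {u v : List (α × Bool)} (hu : Fill π s a u) (hv : Fill π s b v) :
    Fill π s (a + b) (u ++ v) := by
  induction hu with
  | nil k => exact hv.mono (by omega)
  | @pair a₁ a₂ e u₁ u₂ h₁ h₂ ih₁ ih₂ =>
    have := Fill.pair e h₁ ih₂
    simpa [add_assoc] using this
  | @cell k e r u₁ hr he h ih =>
    have := Fill.cell (k := k + b) (v := u₁ ++ v) e r hr he (by simpa using ih)
    simpa [add_right_comm] using this

lemma insert {a b : ℕ} {x y u : List (α × Bool)} (h : Fill π s a (x ++ y)) (hu : Fill π s b u) :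
    Fill π s (a + b) (x ++ u ++ y) := by
  generalize hw : x ++ y = w at h
  induction h generalizing x y with
  | nil k =>
    obtain ⟨rfl, rfl⟩ := List.append_eq_nil_iff.1 hw
    simpa using hu.mono (by omega)
  | @pair a₁ a₂ e p q h₁ h₂ ih₁ ih₂ =>
    cases x with
    | nil =>
      obtain rfl : y = _ := hw
      have := hu.append (Fill.pair e h₁ h₂)
      exact (by simpa using this : Fill π s _ _).mono (by omega)
    | cons g x =>
      simp only [List.cons_append, List.cons.injEq] at hw
      obtain ⟨rfl, hw⟩ := hw
      rcases List.append_eq_append_iff.1 hw with ⟨t, rfl, rfl⟩ | ⟨t, rfl, ht⟩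
      · have := Fill.pair g (ih₁ rfl) h₂
        exact (by simpa using this : Fill π s _ _).mono (by omega)
      · cases t with
        | nil =>
          obtain rfl : _ = y := by simpa using ht
          have := Fill.pair g (ih₁ (x := p) (y := []) (by simp)) h₂
          exact (by simpa using this : Fill π s _ _).mono (by omega)
        | cons f t =>
          simp only [List.cons_append, List.cons.injEq] at ht
          obtain ⟨rfl, rfl⟩ := ht
          have := Fill.pair g h₁ (ih₂ rfl)
          exact (by simpa using this : Fill π s _ _).mono (by omega)
  | @cell k e r v hr he h ih =>
    cases x with
    | nil =>
      obtain rfl : y = _ := hw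
      have := hu.append (Fill.cell e r hr he h)
      exact (by simpa using this : Fill π s _ _).mono (by omega)
    | cons g x =>
      simp only [List.cons_append, List.cons.injEq] at hw
      obtain ⟨rfl, rfl⟩ := hw
      have := ih (x := r ++ x) (y := y) (by simp)
      have := Fill.cell (v := x ++ u ++ y) g r hr he (by simpa using this)
      exact (by simpa using this : Fill π s _ _).mono (by omega)

lemma rotate_of_step {k : ℕ}
    (H : ∀ e v, Fill π s k (e :: v) → Fill π s k (v ++ [e])) {u v : List (α × Bool)}
    (h : Fill π s k (u ++ v)) : Fill π s k (v ++ u) := by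
  induction u generalizing v with
  | nil => simpa using h
  | cons e u ih =>
    have := ih (v := v ++ [e]) (by simpa using H _ _ h)
    simpa using this

lemma cap_aux {k : ℕ}
    (H : ∀ j ≤ k, ∀ u v, Fill π s j (u ++ v) → Fill π s j (v ++ u)) {y c : List (α × Bool)}
    (hc : π (mk c) = 1) (hs : c.length ≤ s) (h : Fill π s k (y ++ c)) : Fill π s (k + 1) y := by
  generalize hw : y ++ c = w at h
  induction h generalizing y with
  | nil k =>
    obtain ⟨rfl, rfl⟩ := List.append_eq_nil_iff.1 hw
    exact nil _
  | @pair a₁ a₂ e p q h₁ h₂ ih₁ ih₂ =>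
    cases y with
    | nil => exact nil _
    | cons g y =>
      simp only [List.cons_append, List.cons.injEq] at hw
      obtain ⟨rfl, hw⟩ := hw
      have key : ∀ t, p = y ++ t → c = t ++ (g.1, !g.2) :: q → Fill π s (a₁ + a₂ + 1) (g :: y) := by
        rintro t rfl rfl
        refine Fill.cell g (q ++ t) (by simp at hs ⊢; omega) ?_ ?_
        · have e1 : (mk (t ++ (g.1, !g.2) :: q) : FreeGroup α) = mk t * (mk [g])⁻¹ * mk q := by
            simp [FreeGroup.inv_mk, FreeGroup.mul_mk, invRev]
          rw [e1] at hc
          simp only [map_mul, map_inv] at hc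
          rw [← FreeGroup.mul_mk, map_mul]
          have h3 : π (mk t) * (π (mk [g]))⁻¹ = (π (mk q))⁻¹ := eq_inv_of_mul_eq_one_left hc
          have h4 : (π (mk [g]))⁻¹ = (π (mk t))⁻¹ * (π (mk q))⁻¹ := by rw [← h3]; group
          rw [← inv_inj, h4]; group
        · have := h₂.append (H a₁ (by omega) _ _ h₁)
          exact (by simpa using this : Fill π s _ _).mono (by omega)
      rcases List.append_eq_append_iff.1 hw with ⟨t, ht, ht'⟩ | ⟨t, rfl, ht⟩
      · exact key t ht ht'
      · cases t with
        | nil => exact key [] (by simp) (by simpa using ht.symm)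
        | cons f t =>
          simp only [List.cons_append, List.cons.injEq] at ht
          obtain ⟨rfl, rfl⟩ := ht
          exact Fill.pair (a := a₁) (b := a₂ + 1) g h₁ (ih₂ (fun j hj => H j (by omega)) rfl)
  | @cell k e r v hr he h ih =>
    cases y with
    | nil => exact nil _
    | cons g y =>
      simp only [List.cons_append, List.cons.injEq] at hw
      obtain ⟨rfl, rfl⟩ := hw
      exact Fill.cell g r hr he (ih (fun j hj => H j (by omega)) (by simp))

lemma rotate {k : ℕ} {u v : List (α × Bool)} (h : Fill π s k (u ++ v)) : Fill π s k (v ++ u) := by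
  induction k using Nat.strong_induction_on generalizing u v with
  | _ k IH =>
  refine rotate_of_step (fun e v hv => ?_) h
  generalize hw : e :: v = w at hv
  cases hv with
  | nil => cases hw
  | @pair a b f p q hp hq =>
    obtain ⟨rfl, rfl⟩ := List.cons.inj hw
    have := hp.append (Fill.pair (e.1, !e.2) hq (Fill.nil 0))
    simpa using this
  | @cell k f r p hr he hp =>
    obtain ⟨rfl, rfl⟩ := List.cons.inj hw
    have h1 := IH k (by omega) hp
    have h2 := h1.insert (Fill.pair e (Fill.nil 0) (Fill.nil 0))
    refine cap_aux (c := (e.1, !e.2) :: r) (fun j hj u v => IH j (by omega)) ?_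
      (by simp; omega) (by simpa using h2)
    have e1 : (mk ((e.1, !e.2) :: r) : FreeGroup α) = (mk [e])⁻¹ * mk r := by
      simp [FreeGroup.inv_mk, FreeGroup.mul_mk, invRev]
    rw [e1, map_mul, map_inv, he]; simp

lemma cap {k : ℕ} {y c : List (α × Bool)} (hc : π (mk c) = 1) (hs : c.length ≤ s)
    (h : Fill π s k (y ++ c)) : Fill π s (k + 1) y :=
  cap_aux (fun _ _ _ _ => rotate) hc hs h

lemma delete {k : ℕ} {x y : List (α × Bool)} {e : α × Bool}
    (h : Fill π s k (x ++ e :: (e.1, !e.2) :: y)) : Fill π s k (x ++ y) := by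
  generalize hw : x ++ e :: (e.1, !e.2) :: y = w at h
  induction h generalizing x y with
  | nil k => simp at hw
  | @pair a b f p q hp hq ihp ihq =>
    cases x with
    | nil =>
      simp only [List.nil_append, List.cons.injEq] at hw
      obtain ⟨rfl, hw⟩ := hw
      cases p with
      | nil =>
        obtain ⟨-, rfl⟩ := List.cons.inj hw
        simpa using hq.mono (by omega)
      | cons g p =>
        simp only [List.cons_append, List.cons.injEq] at hw
        obtain ⟨rfl, rfl⟩ := hw
        have := (rotate (u := [(e.1, !e.2)]) hp).append hq
        simpa using this
    | cons g x =>
      simp only [List.cons_append, List.cons.injEq] at hw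
      obtain ⟨rfl, hw⟩ := hw
      rcases List.append_eq_append_iff.1 hw with ⟨t, rfl, ht⟩ | ⟨t, rfl, ht⟩
      · match t, ht with
        | [], ht =>
          simp only [List.nil_append, List.cons.injEq] at ht
          obtain ⟨rfl, rfl⟩ := ht
          have h2 : Fill π s b ([g] ++ y) := by simpa using hq
          have := h2.insert hp
          exact (by simpa using this : Fill π s _ _).mono (by omega)
        | [e'], ht =>
          simp only [List.cons_append, List.nil_append, List.cons.injEq] at ht
          obtain ⟨rfl, h2, rfl⟩ := ht
          have hge : e = g := by
            rw [Prod.ext_iff] at h2; ext <;> simp_all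
          subst hge
          have := (rotate (v := [e]) hp).append hq
          simpa using this
        | e' :: f' :: t, ht =>
          simp only [List.cons_append, List.cons.injEq] at ht
          obtain ⟨rfl, rfl, rfl⟩ := ht
          have := Fill.pair g (ihp (x := x) (y := t) rfl) hq
          simpa using this
      · cases t with
        | nil =>
          simp only [List.nil_append, List.cons.injEq] at ht
          obtain ⟨rfl, rfl⟩ := ht
          have h2 : Fill π s b ([g] ++ y) := by simpa using hq
          have := h2.insert hp
          exact (by simpa using this : Fill π s _ _).mono (by omega)
        | cons f t =>
          simp only [List.cons_append, List.cons.injEq] at ht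
          obtain ⟨rfl, rfl⟩ := ht
          have := Fill.pair g hp (ihq rfl)
          simpa using this
  | @cell k f r v hr he h ih =>
    cases x with
    | nil =>
      simp only [List.nil_append, List.cons.injEq] at hw
      obtain ⟨rfl, rfl⟩ := hw
      have h1 := rotate (u := r ++ [(e.1, !e.2)]) (v := y) (by simpa using h)
      refine cap (c := r ++ [(e.1, !e.2)]) ?_ (by simp; omega) h1
      have e1 : (mk (r ++ [(e.1, !e.2)]) : FreeGroup α) = mk r * (mk [e])⁻¹ := by
        simp [FreeGroup.inv_mk, FreeGroup.mul_mk, invRev]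
      rw [e1, map_mul, map_inv, he]; simp
    | cons g x =>
      simp only [List.cons_append, List.cons.injEq] at hw
      obtain ⟨rfl, rfl⟩ := hw
      refine Fill.cell g r hr he ?_
      have := ih (x := r ++ x) (y := y) (by simp)
      simpa using this

lemma insert_pair {k : ℕ} {x y : List (α × Bool)} (e : α × Bool) (h : Fill π s k (x ++ y)) :
    Fill π s k (x ++ e :: (e.1, !e.2) :: y) := by
  have := h.insert (Fill.pair e (Fill.nil 0) (Fill.nil 0))
  simpa using this

lemma of_red {k : ℕ} {u v : List (α × Bool)} (h : FreeGroup.Red u v) :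
    Fill π s k u ↔ Fill π s k v := by
  induction h with
  | refl => rfl
  | tail _ hs ih =>
    rw [ih]
    cases hs with
    | not => exact ⟨fun h => delete h, fun h => insert_pair _ h⟩

lemma congr {k : ℕ} {u v : List (α × Bool)} (h : (mk u : FreeGroup α) = mk v) :
    Fill π s k u ↔ Fill π s k v := by
  obtain ⟨w, hu, hv⟩ := FreeGroup.Red.exact.1 h
  exact (of_red hu).trans (of_red hv).symm

end Fill

end

section

open FreeGroup (mk invRev)

variable {α G : Type*} [Group G]

/-- `g` is represented by words bounding disc diagrams with at most `k` cells. -/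
def HasArea (π : FreeGroup α →* G) (s k : ℕ) (g : FreeGroup α) : Prop :=
  ∃ w, mk w = g ∧ Fill π s k w

lemma mk_append (u v : List (α × Bool)) : (mk (u ++ v) : FreeGroup α) = mk u * mk v :=
  FreeGroup.mul_mk.symm

lemma mk_nil : (mk [] : FreeGroup α) = 1 := rfl

lemma append_eq_append_cons {l m u v : List α} {c : α} (h : l ++ m = u ++ c :: v) :
    (∃ y, l = u ++ c :: y ∧ v = y ++ m) ∨ ∃ x, u = l ++ x ∧ m = x ++ c :: v := by
  rcases List.append_eq_append_iff.1 h with ⟨x, hx, hm⟩ | ⟨y, hl, hy⟩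
  · exact Or.inr ⟨x, hx, hm⟩
  · cases y with
    | nil => exact Or.inr ⟨[], by simpa using hl.symm, by simpa using hy.symm⟩
    | cons d y =>
      obtain ⟨rfl, rfl⟩ := List.cons.inj hy
      exact Or.inl ⟨y, hl, rfl⟩

/-- The free group element of a single signed letter. -/
def edge (e : α × Bool) : FreeGroup α := mk [e]

lemma mk_cons (v : List (α × Bool)) (e : α × Bool) :
    (mk (e :: v) : FreeGroup α) = edge e * mk v :=
  mk_append [e] v

lemma edge_flip (e : α × Bool) : edge (e.1, !e.2) = (edge e)⁻¹ := by
  simp [edge, FreeGroup.inv_mk, invRev]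

variable {π : FreeGroup α →* G} {s k l : ℕ} {g h : FreeGroup α}

lemma hasArea_mk {w : List (α × Bool)} : HasArea π s k (mk w) ↔ Fill π s k w :=
  ⟨fun ⟨_, hv, hf⟩ => (Fill.congr hv).1 hf, fun h => ⟨w, rfl, h⟩⟩

namespace HasArea

lemma mono (hg : HasArea π s k g) (hkl : k ≤ l) : HasArea π s l g :=
  let ⟨w, hw, hf⟩ := hg
  ⟨w, hw, hf.mono hkl⟩

lemma one : HasArea π s 0 1 := ⟨[], rfl, Fill.nil 0⟩

lemma mul (hg : HasArea π s k g) (hh : HasArea π s l h) : HasArea π s (k + l) (g * h) := by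
  obtain ⟨u, rfl, hu⟩ := hg
  obtain ⟨v, rfl, hv⟩ := hh
  exact ⟨u ++ v, mk_append u v, hu.append hv⟩

lemma rotate (hg : HasArea π s k (g * h)) : HasArea π s k (h * g) := by
  obtain ⟨u, rfl⟩ := Quot.exists_rep g
  obtain ⟨v, rfl⟩ := Quot.exists_rep h
  exact ⟨v ++ u, mk_append v u, Fill.rotate (hasArea_mk.1 (mk_append u v ▸ hg))⟩

lemma rotate_append {u v : List (α × Bool)} (h : HasArea π s k (mk (u ++ v))) :
    HasArea π s k (mk v * mk u) :=
  rotate (mk_append u v ▸ h)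

lemma conj (hg : HasArea π s k g) (x : FreeGroup α) : HasArea π s k (x * g * x⁻¹) := by
  have : HasArea π s k ((g * x⁻¹) * x) := by simpa using hg
  simpa [mul_assoc] using this.rotate

lemma of_eq (hg : HasArea π s k g) (e : g = h) : HasArea π s k h := e ▸ hg

lemma of_short {c : List (α × Bool)} (hc : π (mk c) = 1) (hs : c.length ≤ s) :
    HasArea π s 1 (mk c) := by
  have h : Fill π s 0 ((invRev c) ++ c) :=
    hasArea_mk.1 (one.of_eq (by rw [mk_append, ← FreeGroup.inv_mk, inv_mul_cancel]))
  have h1 : Fill π s 1 (c ++ []) := by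
    refine Fill.cap (c := invRev c) ?_ (by simpa using hs) ?_
    · rw [← FreeGroup.inv_mk, map_inv, hc, inv_one]
    · simpa using h.rotate
  exact hasArea_mk.2 (by simpa using h1)

lemma inv (hg : HasArea π s k g) : HasArea π s k g⁻¹ := by
  obtain ⟨w, rfl, hw⟩ := hg
  induction hw with
  | nil k => exact (one.mono (Nat.zero_le k)).of_eq (by simp [mk_nil])
  | @pair a b e u v hu hv ihu ihv =>
    refine ((ihv.mul (ihu.conj (edge e))).mono (by omega)).of_eq ?_
    rw [mk_cons, mk_append, mk_cons, edge_flip]; group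
  | @cell k e r v hr he h ih =>
    have h1 : HasArea π s 1 (mk (r ++ [(e.1, !e.2)])) := by
      refine of_short ?_ (by simpa using hr)
      rw [mk_append, mk_cons, mk_nil, edge_flip, mul_one, map_mul, map_inv, edge, he, mul_inv_cancel]
    refine (ih.mul h1).of_eq ?_
    rw [mk_append, mk_append, mk_cons, mk_cons, mk_nil, edge_flip]; group

lemma map_eq_one (hg : HasArea π s k g) : π g = 1 := by
  obtain ⟨w, rfl, hw⟩ := hg
  induction hw with
  | nil k => simp [mk_nil]
  | @pair a b e u v hu hv ihu ihv =>
    simp only [mk_cons, mk_append, edge_flip, map_mul, map_inv, ihu, ihv]; group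
  | @cell k e r v hr he h ih =>
    rw [mk_cons, map_mul, edge, he, ← map_mul, ← mk_append, ih]

lemma cases_cons {e : α × Bool} {v : List (α × Bool)} (hg : HasArea π s k (mk (e :: v))) :
    (∃ r l, r.length < s ∧ HasArea π s 1 (mk r * (edge e)⁻¹) ∧ k = l + 1 ∧
      HasArea π s l (mk r * mk v)) ∨
    ∃ u v' k₁ k₂, v = u ++ (e.1, !e.2) :: v' ∧ k₁ + k₂ ≤ k ∧
      HasArea π s k₁ (mk u) ∧ HasArea π s k₂ (mk v') := by
  have hw := hasArea_mk.1 hg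
  generalize hw' : e :: v = w at hw
  cases hw with
  | nil => cases hw'
  | pair f hp hq =>
    obtain ⟨rfl, rfl⟩ := List.cons.inj hw'
    exact Or.inr ⟨_, _, _, _, rfl, le_rfl, hasArea_mk.2 hp, hasArea_mk.2 hq⟩
  | cell f r hr he hp =>
    obtain ⟨rfl, rfl⟩ := List.cons.inj hw'
    refine Or.inl ⟨r, _, hr, ?_, rfl, ?_⟩
    · refine (of_short (c := r ++ [(e.1, !e.2)]) ?_ (by simpa using hr)).of_eq
        (by rw [mk_append, mk_cons, mk_nil, edge_flip, mul_one])
      rw [mk_append, mk_cons, mk_nil, edge_flip, mul_one, map_mul, map_inv, edge, he, mul_inv_cancel]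
    · rw [← mk_append]; exact hasArea_mk.2 hp

end HasArea

/-- Data of a shortcut `q`, of length at most `τ`, from a point of the side `A` to a point of the
current front; `P` and `N` are read along the two halves of the rest of the collar. -/
def Split (π : FreeGroup α →* G) (s k : ℕ) (A : List (α × Bool)) (τ U : ℕ) (P N : FreeGroup α) :
    Prop :=
  ∃ a₁ a₂ q B₁ B₂, A = a₁ ++ a₂ ∧ q.length ≤ τ ∧ B₁ + B₂ + U ≤ k ∧
    HasArea π s B₁ (P * mk a₁ * mk q) ∧ HasArea π s B₂ (N * (mk q)⁻¹ * mk a₂)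

lemma Split.change {A : List (α × Bool)} {τ τ' U U' j j' : ℕ} {P P' N N' : FreeGroup α}
    (h : Split π s k A τ U P N) (hP : HasArea π s j (P' * P⁻¹)) (hN : HasArea π s j' (N' * N⁻¹))
    (hU : j + j' + U' ≤ U) (hτ : τ ≤ τ') : Split π s k A τ' U' P' N' := by
  obtain ⟨a₁, a₂, q, B₁, B₂, hA, hq, hB, h₁, h₂⟩ := h
  refine ⟨a₁, a₂, q, j + B₁, j' + B₂, hA, hq.trans hτ, by omega,
    (hP.mul h₁).of_eq (by group), (hN.mul h₂).of_eq (by group)⟩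

/-- The loop `A₁ A₂ A₃ A₄` is cut by a path of length at most `τ` between points of `A₁`
and `A₃`. -/
def Cut (π : FreeGroup α →* G) (s k : ℕ) (A₁ A₂ A₃ A₄ : List (α × Bool)) (τ : ℕ) : Prop :=
  ∃ a₁ a₂ c₁ c₂ q k₁ k₂, A₁ = a₁ ++ a₂ ∧ A₃ = c₁ ++ c₂ ∧ q.length ≤ τ ∧ k₁ + k₂ ≤ k ∧
    HasArea π s k₁ (mk a₂ * mk A₂ * mk c₁ * (mk q)⁻¹) ∧
    HasArea π s k₂ (mk a₁ * mk q * mk c₂ * mk A₄)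

lemma layer {A₁ A₂ A₃ A₄ : List (α × Bool)} {τ : ℕ} (hcut : ¬ Cut π s k A₁ A₂ A₃ A₄ τ)
    (n : ℕ) : ∀ (b₁ b₂ d₁ d₂ x y : List (α × Bool)) (U : ℕ), y.length ≤ n → A₂ = b₁ ++ b₂ →
    A₄ = d₁ ++ d₂ → HasArea π s U (mk x * mk y * mk b₂ * mk A₃ * mk d₁) →
    (∀ x₁ x₂, x = x₁ ++ x₂ →
      Split π s k A₁ (τ + s) U ((mk x₁)⁻¹ * mk d₂) (mk b₁ * (mk x₂ * mk y)⁻¹)) →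
    (∀ y₁ y₂, y = y₁ ++ y₂ →
      Split π s k A₁ τ U ((mk x * mk y₁)⁻¹ * mk d₂) (mk b₁ * (mk y₂)⁻¹)) →
    ∃ b₁' b₂' d₁' d₂' z U', A₂ = b₁' ++ b₂' ∧ A₄ = d₁' ++ d₂' ∧
      HasArea π s U' (mk z * mk b₂' * mk A₃ * mk d₁') ∧ z.length + s * U' ≤ x.length + s * U ∧
      ∀ z₁ z₂, z = z₁ ++ z₂ →
        Split π s k A₁ (τ + s) U' ((mk z₁)⁻¹ * mk d₂') (mk b₁' * (mk z₂)⁻¹) := by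
  induction n with
  | zero =>
    intro b₁ b₂ d₁ d₂ x y U hy hb hd hU hx _
    obtain rfl : y = [] := List.length_eq_zero_iff.1 (by omega)
    exact ⟨b₁, b₂, d₁, d₂, x, U, hb, hd, by simpa [mk_nil] using hU, le_rfl,
      fun z₁ z₂ hz => by simpa [mk_nil] using hx z₁ z₂ hz⟩
  | succ n ih =>
    intro b₁ b₂ d₁ d₂ x y U hy hb hd hU hx hy'
    cases y with
    | nil => exact ⟨b₁, b₂, d₁, d₂, x, U, hb, hd, by simpa [mk_nil] using hU, le_rfl,
        fun z₁ z₂ hz => by simpa [mk_nil] using hx z₁ z₂ hz⟩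
    | cons e t =>
    have hy0 := hy' [] _ rfl
    have hyc : ∀ y₁ y₂, t = y₁ ++ y₂ →
      Split π s k A₁ τ U ((mk x * (edge e * mk y₁))⁻¹ * mk d₂) (mk b₁ * (mk y₂)⁻¹) := by
      rintro y₁ y₂ rfl
      have := hy' (e :: y₁) y₂ rfl
      rwa [mk_cons] at this
    simp only [mk_cons t e] at hx hy0 hU
    rw [mk_nil, mul_one] at hy0
    have hU' : HasArea π s U (mk (e :: (t ++ (b₂ ++ (A₃ ++ (d₁ ++ x)))))) := by
      refine (hU.conj (mk x)⁻¹).of_eq ?_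
      simp only [mk_cons, mk_append]; group
    have hyn : t.length ≤ n := by simpa using hy
    rcases hU'.cases_cons with ⟨r, l, hr, her, rfl, hl⟩ | ⟨u, v, k₁, k₂, hw, hk, hu, hv⟩
    · have H :=
        ih b₁ b₂ d₁ d₂ (x ++ r) t l hyn hb hd ?_ ?_ ?_
      · obtain ⟨b₁', b₂', d₁', d₂', z, U', h1, h2, h3, h4, h5⟩ := H
        refine ⟨b₁', b₂', d₁', d₂', z, U', h1, h2, h3, ?_, h5⟩
        rw [List.length_append] at h4
        nlinarith
      · refine (hl.conj (mk x)).of_eq ?_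
        simp only [mk_append]; group
      · intro x₁ x₂ hx'
        rcases List.append_eq_append_iff.1 hx' with ⟨r₁, rfl, rfl⟩ | ⟨x₃, rfl, rfl⟩
        · obtain ⟨a₁, a₂, q, B₁, B₂, hA, hq, hB, h₁, h₂⟩ := hy0
          refine ⟨a₁, a₂, q ++ r₁, B₁, B₂ + 1, hA, ?_, by omega, ?_, ?_⟩
          · simp at hr ⊢; omega
          · refine (h₁.conj (mk r₁)⁻¹).of_eq ?_
            simp only [mk_append]; group
          · refine (h₂.mul (her.inv.conj ((mk a₂)⁻¹ * mk q))).of_eq ?_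
            simp only [mk_append]; group
        · refine (hx _ _ rfl).change (HasArea.one.of_eq ?_) (j' := 1) (her.inv.conj ?_ |>.of_eq ?_)
            (by omega) le_rfl
          · group
          · exact mk b₁ * (mk t)⁻¹ * (edge e)⁻¹
          · simp only [mk_append]; group
      · rintro y₁ y₂ rfl
        refine (hyc _ _ rfl).change (j := 1) (her.inv.conj ?_ |>.of_eq ?_)
            (HasArea.one.of_eq ?_) (by omega) le_rfl
        · exact (mk y₁)⁻¹ * (mk r)⁻¹
        · simp only [mk_append]; group
        · group
    · rcases append_eq_append_cons hw with ⟨y, rfl, rfl⟩ | ⟨u, rfl, hw2⟩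
      · have H :=
          ih b₁ b₂ d₁ d₂ x y k₂ (by simp at hyn ⊢; omega) hb hd ?_ ?_ ?_
        · obtain ⟨b₁', b₂', d₁', d₂', z, U', h1, h2, h3, h4, h5⟩ := H
          exact ⟨b₁', b₂', d₁', d₂', z, U', h1, h2, h3, by nlinarith, h5⟩
        · refine (hv.conj (mk x)).of_eq ?_
          simp only [mk_append]; group
        · intro x₁ x₂ hx'
          refine (hx _ _ hx').change (HasArea.one.of_eq ?_) (hu.conj ?_ |>.of_eq ?_)
            (j' := k₁) (U' := k₂) (by omega) le_rfl
          · group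
          · exact mk b₁ * (mk y)⁻¹ * edge e
          · simp only [mk_append, mk_cons, edge_flip]; group
        · rintro y₁ y₂ rfl
          have := hyc (u ++ (e.1, !e.2) :: y₁) y₂ (by simp)
          simp only [mk_append, mk_cons, edge_flip] at this
          refine this.change (j := k₁) (hu.conj ((mk y₁)⁻¹ * edge e) |>.of_eq ?_)
            (HasArea.one.of_eq ?_) (U' := k₂) (by omega) le_rfl
          · group
          · group
      rcases append_eq_append_cons hw2 with ⟨y, rfl, rfl⟩ | ⟨u, rfl, hw3⟩
      · have H :=
          ih (b₁ ++ u ++ [(e.1, !e.2)]) y d₁ d₂ x [] k₂ (by simp) (by simp [hb]) hd ?_ ?_ ?_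
        · obtain ⟨b₁', b₂', d₁', d₂', z, U', h1, h2, h3, h4, h5⟩ := H
          exact ⟨b₁', b₂', d₁', d₂', z, U', h1, h2, h3, by nlinarith, h5⟩
        · refine (hv.conj (mk x)).of_eq ?_
          simp only [mk_append, mk_nil]; group
        · intro x₁ x₂ hx'
          refine (hx _ _ hx').change (HasArea.one.of_eq ?_) (hu.rotate_append.conj ?_ |>.of_eq ?_)
            (j' := k₁) (U' := k₂) (by omega) le_rfl
          · group
          · exact mk b₁
          · simp only [mk_append, mk_cons, edge_flip, mk_nil]; group
        · intro y₁ y₂ hy''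
          obtain ⟨rfl, rfl⟩ := List.append_eq_nil_iff.1 hy''.symm
          refine hy0.change (HasArea.one.of_eq ?_) (hu.rotate_append.conj ?_ |>.of_eq ?_)
            (j' := k₁) (U' := k₂) (by omega) le_rfl
          · simp only [mk_nil]; group
          · exact mk b₁
          · simp only [mk_append, mk_cons, edge_flip, mk_nil]; group
      rcases append_eq_append_cons hw3 with ⟨y, rfl, rfl⟩ | ⟨u, rfl, hw4⟩
      · refine absurd ?_ hcut
        obtain ⟨a₁, a₂, q, B₁, B₂, hA, hq, hB, h₁, h₂⟩ := hy0
        refine ⟨a₁, a₂, u ++ [(e.1, !e.2)], y, q, B₂ + k₁, B₁ + k₂, hA, by simp, hq, by omega,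
          ?_, ?_⟩
        · refine ((h₂.conj (mk a₂)).mul (hu.conj (mk q * edge e))).of_eq ?_
          subst hb
          simp only [mk_append, mk_cons, edge_flip, mk_nil]; group
        · refine ((h₁.conj (mk a₁ * mk q)).mul (hv.conj ((mk d₂)⁻¹ * mk x))).of_eq ?_
          subst hd
          simp only [mk_append]; group
      rcases append_eq_append_cons hw4 with ⟨y, rfl, rfl⟩ | ⟨u, rfl, rfl⟩
      · have H :=
          ih b₁ b₂ u ((e.1, !e.2) :: y ++ d₂) [] t k₁ hyn hb (by simp [hd]) ?_ ?_ ?_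
        · obtain ⟨b₁', b₂', d₁', d₂', z, U', h1, h2, h3, h4, h5⟩ := H
          refine ⟨b₁', b₂', d₁', d₂', z, U', h1, h2, h3, ?_, h5⟩
          simp at h4
          nlinarith
        · refine hu.of_eq ?_
          simp only [mk_append, mk_nil]; group
        · intro x₁ x₂ hx'
          obtain ⟨rfl, rfl⟩ := List.append_eq_nil_iff.1 hx'.symm
          refine (hyc [] t rfl).change (hv.conj (edge e)⁻¹ |>.of_eq ?_) (HasArea.one.of_eq ?_)
            (j := k₂) (U' := k₁) (by omega) (by omega)
          · simp only [mk_append, mk_cons, edge_flip, mk_nil]; group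
          · simp only [mk_nil]; group
        · intro y₁ y₂ hy''
          refine (hyc y₁ y₂ hy'').change (hv.conj ((mk y₁)⁻¹ * (edge e)⁻¹) |>.of_eq ?_)
            (HasArea.one.of_eq ?_) (j := k₂) (U' := k₁) (by omega) le_rfl
          · simp only [mk_append, mk_cons, edge_flip, mk_nil]; group
          · group
      · have H :=
          ih b₁ b₂ d₁ d₂ u t k₁ hyn hb hd ?_ ?_ ?_
        · obtain ⟨b₁', b₂', d₁', d₂', z, U', h1, h2, h3, h4, h5⟩ := H
          refine ⟨b₁', b₂', d₁', d₂', z, U', h1, h2, h3, ?_, h5⟩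
          simp
          nlinarith
        · refine (hu.conj (mk u)).of_eq ?_
          simp only [mk_append]; group
        · rintro x₁ x₂ rfl
          have := hx x₁ (x₂ ++ (e.1, !e.2) :: v) (by simp)
          refine this.change (HasArea.one.of_eq ?_)
            (hv.conj (mk b₁ * (mk t)⁻¹ * (edge e)⁻¹) |>.of_eq ?_)
            (j' := k₂) (U' := k₁) (by omega) le_rfl
          · group
          · simp only [mk_append, mk_cons, edge_flip]; group
        · intro y₁ y₂ hy''
          refine (hyc y₁ y₂ hy'').change (hv.conj ((mk y₁)⁻¹ * (edge e)⁻¹) |>.of_eq ?_)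
            (HasArea.one.of_eq ?_) (j := k₂) (U' := k₁) (by omega) le_rfl
          · simp only [mk_append, mk_cons, edge_flip]; group
          · group

/-- A loop cut into four sides has a shortcut between opposite sides, whose length is controlled
by the number of cells. -/
theorem rect {A₁ A₂ A₃ A₄ : List (α × Bool)} {T : ℕ} (hT : 1 ≤ T)
    (h : HasArea π s k (mk (A₁ ++ A₂ ++ A₃ ++ A₄))) :
    Cut π s k A₁ A₂ A₃ A₄ (s * T) ∨ Cut π s k A₄ A₁ A₂ A₃ (s * k / T) := by
  by_contra! hcon
  obtain ⟨hcut, hcon⟩ := hcon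
  have key : ∀ t ≤ T, ∃ b₁ b₂ d₁ d₂ z U, A₂ = b₁ ++ b₂ ∧ A₄ = d₁ ++ d₂ ∧
      HasArea π s U (mk z * mk b₂ * mk A₃ * mk d₁) ∧ T * U + t * (k + 1) ≤ T * k ∧
      ∀ z₁ z₂, z = z₁ ++ z₂ →
        Split π s k A₁ (s * t) U ((mk z₁)⁻¹ * mk d₂) (mk b₁ * (mk z₂)⁻¹) := by
    intro t
    induction t with
    | zero =>
      refine fun _ => ⟨[], A₂, A₄, [], A₁, k, by simp, by simp, ?_, by simp, ?_⟩
      · simpa only [mk_append] using h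
      · rintro z₁ z₂ rfl
        refine ⟨z₁, z₂, [], 0, 0, rfl, by simp, by omega, HasArea.one.of_eq ?_,
          HasArea.one.of_eq ?_⟩ <;> simp only [mk_nil] <;> group
    | succ t ih =>
      intro ht
      obtain ⟨b₁, b₂, d₁, d₂, z, U, hb, hd, hU, hk, hz⟩ := ih (by omega)
      have hcut' : ¬ Cut π s k A₁ A₂ A₃ A₄ (s * t) := by
        rintro ⟨a₁, a₂, c₁, c₂, q, k₁, k₂, h1, h2, h3, h4⟩
        exact hcut ⟨a₁, a₂, c₁, c₂, q, k₁, k₂, h1, h2,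
          h3.trans (Nat.mul_le_mul le_rfl (by omega)), h4⟩
      have H :=
        layer hcut' z.length b₁ b₂ d₁ d₂ [] z U le_rfl hb hd
        (by simpa [mk_nil] using hU) ?_ ?_
      · obtain ⟨b₁', b₂', d₁', d₂', z', U', hb', hd', hU', hl, hs⟩ := H
        refine ⟨b₁', b₂', d₁', d₂', z', U', hb', hd', hU', ?_, by simpa [mul_add] using hs⟩
        by_contra hlt
        obtain ⟨a₁, a₂, q, B₁, B₂, hA, hq, hB, h₁, h₂⟩ := hs [] z' rfl
        refine hcon ⟨d₁', d₂', b₁', b₂', z', B₁ + B₂, U', hd', hb', ?_, by omega, ?_, ?_⟩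
        · rw [Nat.le_div_iff_mul_le hT]
          have hl' : z'.length + s * U' ≤ s * U := by simpa using hl
          have h5 : T * U ≤ T * U' + k := by
            have := add_one_mul t (k + 1); omega
          have h6 : s * (T * U) ≤ s * (T * U' + k) := Nat.mul_le_mul le_rfl h5
          nlinarith
        · refine (h₁.mul (h₂.conj ((mk q)⁻¹ * mk a₂))).of_eq ?_
          rw [hA]
          simp only [mk_append, mk_nil]; group
        · refine (hU'.conj (mk d₁')).of_eq ?_
          group
      · intro x₁ x₂ hx
        obtain ⟨rfl, rfl⟩ := List.append_eq_nil_iff.1 hx.symm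
        refine (hz [] z rfl).change (U' := U) (HasArea.one.of_eq ?_) (HasArea.one.of_eq ?_)
          (by omega) (by omega) <;> simp only [mk_nil] <;> group
      · intro y₁ y₂ hy
        simpa [mk_nil] using hz y₁ y₂ hy
  obtain ⟨_, _, _, _, _, U, _, _, _, hk, _⟩ := key T le_rfl
  nlinarith

end

section

open FreeGroup (mk invRev)

variable {α G : Type*} [Group G] {π : FreeGroup α →* G} {s k : ℕ}

lemma Cut.pieces {A₁ A₂ A₃ A₄ : List (α × Bool)} {τ : ℕ} (h : Cut π s k A₁ A₂ A₃ A₄ τ) :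
    ∃ w₁ w₂ k₁ k₂, k₁ + k₂ ≤ k ∧ HasArea π s k₁ (mk w₁) ∧ HasArea π s k₂ (mk w₂) ∧
      w₁.length + w₂.length ≤ A₁.length + A₂.length + A₃.length + A₄.length + 2 * τ ∧
      w₁.length ≤ A₁.length + A₂.length + A₃.length + τ ∧
      w₂.length ≤ A₁.length + A₃.length + A₄.length + τ ∧
      ∀ s' i j, HasArea π s' i (mk w₁) → HasArea π s' j (mk w₂) →
        HasArea π s' (i + j) (mk (A₁ ++ A₂ ++ A₃ ++ A₄)) := by
  obtain ⟨a₁, a₂, c₁, c₂, q, k₁, k₂, rfl, rfl, hq, hk, h₁, h₂⟩ := h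
  refine ⟨a₂ ++ A₂ ++ c₁ ++ invRev q, a₁ ++ q ++ c₂ ++ A₄, k₁, k₂, hk, ?_, ?_, ?_, ?_, ?_,
    fun s' i j hi hj => ?_⟩
  · simpa only [mk_append, FreeGroup.inv_mk] using h₁
  · simpa only [mk_append] using h₂
  · simp only [List.length_append, FreeGroup.invRev_length]; omega
  · simp only [List.length_append, FreeGroup.invRev_length]; omega
  · simp only [List.length_append]; omega
  · refine ((hi.conj (mk a₁)).mul hj).of_eq ?_
    simp only [mk_append, ← FreeGroup.inv_mk]; group

lemma bisect {w : List (α × Bool)} {T : ℕ} (hT : 1 ≤ T) (hk : k ≤ T ^ 2)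
    (h : HasArea π s k (mk w)) :
    ∃ w₁ w₂ k₁ k₂, k₁ + k₂ ≤ k ∧ HasArea π s k₁ (mk w₁) ∧ HasArea π s k₂ (mk w₂) ∧
      w₁.length + w₂.length ≤ w.length + 2 * (s * T) ∧
      4 * w₁.length ≤ 3 * w.length + 3 + 4 * (s * T) ∧
      4 * w₂.length ≤ 3 * w.length + 3 + 4 * (s * T) ∧
      ∀ s' i j, HasArea π s' i (mk w₁) → HasArea π s' j (mk w₂) → HasArea π s' (i + j) (mk w) := by
  obtain ⟨A₁, B₁, h₁, hA₁⟩ : ∃ A B, w = A ++ B ∧ A.length = w.length / 4 :=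
    ⟨_, _, (List.take_append_drop (w.length / 4) w).symm, by simp; omega⟩
  have hB₁ : A₁.length + B₁.length = w.length := by rw [h₁]; simp
  obtain ⟨A₂, B₂, rfl, hA₂⟩ : ∃ A B, B₁ = A ++ B ∧ A.length = w.length / 4 :=
    ⟨_, _, (List.take_append_drop (w.length / 4) B₁).symm, by simp; omega⟩
  rw [List.length_append] at hB₁
  obtain ⟨A₃, A₄, rfl, hA₃⟩ : ∃ A B, B₂ = A ++ B ∧ A.length = w.length / 4 :=
    ⟨_, _, (List.take_append_drop (w.length / 4) B₂).symm, by simp; omega⟩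
  rw [List.length_append] at hB₁
  have hw : A₁ ++ A₂ ++ A₃ ++ A₄ = w := by simp [h₁]
  have hsk : s * k / T ≤ s * T := by
    refine Nat.div_le_of_le_mul ?_
    calc s * k ≤ s * T ^ 2 := Nat.mul_le_mul le_rfl hk
      _ = T * (s * T) := by ring
  rcases rect hT (hw ▸ h) with hc | hc
  · obtain ⟨w₁, w₂, k₁, k₂, hk, h1, h2, h3, h4, h5, h6⟩ := hc.pieces
    exact ⟨w₁, w₂, k₁, k₂, hk, h1, h2, by omega, by omega, by omega, hw ▸ h6⟩
  · obtain ⟨w₁, w₂, k₁, k₂, hk, h1, h2, h3, h4, h5, h6⟩ := hc.pieces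
    refine ⟨w₁, w₂, k₁, k₂, hk, h1, h2, by omega, by omega, by omega, fun s' i j hi hj => ?_⟩
    have := h6 s' i j hi hj
    rw [List.append_assoc, List.append_assoc] at this
    refine this.rotate_append.of_eq ?_
    rw [← mk_append, ← hw]; simp

lemma coarsen {M T D : ℕ} (hM : 1 ≤ M) (hT : 1 ≤ T)
    (hD : ∀ w : List (α × Bool), w.length ≤ D → π (mk w) = 1 → ∃ k ≤ T ^ 2, HasArea π M k (mk w))
    (w : List (α × Bool)) (hw : w.length ≤ D) (hw1 : π (mk w) = 1) :
    ∃ N, HasArea π (16 * (M * T)) N (mk w) ∧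
      (N * (M * T) ≤ M * T ∨ N * (M * T) + 2 * (M * T) ≤ w.length) := by
  induction hn : w.length using Nat.strong_induction_on generalizing w with
  | _ n ih =>
  have hτ : 1 ≤ M * T := Nat.mul_pos hM hT
  by_cases hs : n ≤ 16 * (M * T)
  · exact ⟨1, HasArea.of_short hw1 (by omega), Or.inl (by simp)⟩
  · obtain ⟨k, hk, hkw⟩ := hD w hw hw1
    obtain ⟨w₁, w₂, k₁, k₂, -, h1, h2, h3, h4, h5, h6⟩ := bisect hT hk hkw
    obtain ⟨N₁, hN₁, hb₁⟩ := ih w₁.length (by omega) w₁ (by omega) h1.map_eq_one rfl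
    obtain ⟨N₂, hN₂, hb₂⟩ := ih w₂.length (by omega) w₂ (by omega) h2.map_eq_one rfl
    refine ⟨N₁ + N₂, h6 _ _ _ hN₁ hN₂, Or.inr ?_⟩
    rw [add_mul]
    omega

lemma two_pieces_le {E n x y : ℕ} (hx : 400 * x ≤ 305 * n) (hy : 400 * y ≤ 305 * n)
    (hxy : 100 * (x + y) ≤ 102 * n) (hEs : E * s ^ 2 ≤ E * s * n)
    (hEn : 1000 * (E * s * n) ≤ n ^ 2) :
    x ^ 2 + 16 * E * s * x + E * s ^ 2 + (y ^ 2 + 16 * E * s * y + E * s ^ 2) ≤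
      n ^ 2 + 16 * E * s * n + E * s ^ 2 := by
  have hx2 : 400 * x ^ 2 ≤ 305 * (n * x) := by nlinarith
  have hy2 : 400 * y ^ 2 ≤ 305 * (n * y) := by nlinarith
  have hn3 : 100 * (n * x + n * y) ≤ 102 * n ^ 2 := by nlinarith
  have hE2 := Nat.mul_le_mul (le_refl (E * s)) hxy
  have h0 := Nat.zero_le (E * s * n)
  zify at *
  nlinarith only [hx2, hy2, hn3, hE2, h0, hEs, hEn]

/-- If the isoperimetric function is slightly subquadratic on a large range, then it is
subquadratic with a small constant everywhere. -/
lemma extend {E D : ℕ} (hE : 80000 ≤ E) (hs : 1 ≤ s) (hD : 1000 * E * s ≤ D)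
    (hlow : ∀ w : List (α × Bool), w.length ≤ D → π (mk w) = 1 → ∃ N, HasArea π s N (mk w) ∧
      E * s ^ 2 * N ≤ w.length ^ 2 + 16 * E * s * w.length + E * s ^ 2)
    (k n : ℕ) (w : List (α × Bool)) (hn : w.length = n) (hw : HasArea π s k (mk w)) :
    ∃ N ≤ k, HasArea π s N (mk w) ∧ E * s ^ 2 * N ≤ n ^ 2 + 16 * E * s * n + E * s ^ 2 := by
  induction k using Nat.strong_induction_on generalizing n w with
  | _ k ihk =>
  induction n using Nat.strong_induction_on generalizing w k with
  | _ n ihn =>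
  by_cases hmin : ∃ j < k, HasArea π s j (mk w)
  · obtain ⟨j, hj, hjw⟩ := hmin
    obtain ⟨N, hN, h⟩ := ihk j hj n w hn hjw
    exact ⟨N, by omega, h⟩
  push Not at hmin
  replace hmin : ∀ j, HasArea π s j (mk w) → k ≤ j := fun j hj => by
    by_contra! hlt; exact hmin j hlt hj
  by_cases hnD : n ≤ D
  · obtain ⟨N, hN, h⟩ := hlow w (by omega) hw.map_eq_one
    exact ⟨k, le_rfl, hw, hn ▸ (Nat.mul_le_mul le_rfl (hmin N hN)).trans h⟩
  push Not at hnD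
  have ih : ∀ j ≤ k, ∀ v : List (α × Bool), v.length < n → HasArea π s j (mk v) → ∃ N ≤ j,
      HasArea π s N (mk v) ∧
      E * s ^ 2 * N ≤ v.length ^ 2 + 16 * E * s * v.length + E * s ^ 2 := by
    intro j hj v hv hjv
    rcases hj.lt_or_eq with hj | rfl
    · exact ihk j hj _ v rfl hjv
    · exact ihn _ hv _ ihk v rfl hjv
  have hk : E * s ^ 2 * k ≤ (n + s) ^ 2 + 16 * E * s * (n + s) + 2 * (E * s ^ 2) := by
    cases w with
    | nil => simp at hn; omega
    | cons e v =>
    rw [List.length_cons] at hn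
    rcases hw.cases_cons with ⟨r, l, hr, her, rfl, hl⟩ | ⟨u, v', k₁, k₂, rfl, hk, hu, hv⟩
    · rw [← mk_append] at hl
      obtain ⟨N, hN, hNw, hb⟩ := ihk l (by omega) _ _ rfl hl
      have : HasArea π s (1 + N) (mk (e :: v)) := by
        refine (her.inv.mul hNw).of_eq ?_
        rw [mk_cons, mk_append]; group
      have h1 : l + 1 = N + 1 := by have := hmin _ this; omega
      have h2 : (r ++ v).length ≤ n + s := by rw [List.length_append]; omega
      have h3 : (r ++ v).length ^ 2 ≤ (n + s) ^ 2 := Nat.pow_le_pow_left h2 2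
      have h4 := Nat.mul_le_mul (le_refl (16 * E * s)) h2
      rw [h1, mul_add, mul_one]
      omega
    · rw [List.length_append, List.length_cons] at hn
      obtain ⟨N₁, -, h₁, hb₁⟩ := ih k₁ (by omega) u (by omega) hu
      obtain ⟨N₂, -, h₂, hb₂⟩ := ih k₂ (by omega) v' (by omega) hv
      have : HasArea π s (N₁ + N₂) (mk (e :: (u ++ (e.1, !e.2) :: v'))) := by
        refine ((h₁.conj (edge e)).mul h₂).of_eq ?_
        rw [mk_cons, mk_append, mk_cons, edge_flip]; group
      have h1 := Nat.mul_le_mul (le_refl (E * s ^ 2)) (hmin _ this)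
      rw [mul_add] at h1
      have h3 : u.length ^ 2 + v'.length ^ 2 ≤ (n + s) ^ 2 := by nlinarith
      have h4 := Nat.mul_le_mul (le_refl (16 * E * s)) (show u.length + v'.length ≤ n + s by omega)
      rw [mul_add] at h4
      omega
  obtain ⟨T, hT⟩ : ∃ T, T = n / (100 * s) := ⟨_, rfl⟩
  have hT1 : 100 * (s * T) ≤ n := by
    have := Nat.div_mul_le_self n (100 * s); rw [hT]; linarith
  have hn1 : 1000 * (E * s) ≤ n := by linarith
  have hT2 : n ≤ 200 * (s * T) := by
    have h1 := Nat.lt_div_mul_add (a := n) (b := 100 * s) (by omega)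
    rw [← hT] at h1
    have h2 : 200 * s ≤ n := by nlinarith
    linarith
  have hEs : E * s ^ 2 ≤ E * s * n := by
    have : s ≤ n := by nlinarith
    calc E * s ^ 2 = E * s * s := by ring
      _ ≤ E * s * n := Nat.mul_le_mul le_rfl this
  have hEn : 1000 * (E * s * n) ≤ n ^ 2 := by nlinarith
  have hsn : 1000 * s ≤ n := by nlinarith
  have hkT : k ≤ T ^ 2 := by
    have h1 : (n + s) ^ 2 ≤ 2 * n ^ 2 - n ^ 2 / 2 := by
      refine Nat.le_sub_of_add_le ?_
      have := Nat.div_mul_le_self (n ^ 2) 2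
      nlinarith
    have h2 : 16 * E * s * (n + s) ≤ 32 * (E * s * n) := by nlinarith
    have h3 : n ^ 2 ≤ (200 * (s * T)) ^ 2 := Nat.pow_le_pow_left hT2 2
    have h4 : E * s ^ 2 * k ≤ E * s ^ 2 * T ^ 2 := by
      have h5 : 80000 * (s ^ 2 * T ^ 2) ≤ E * (s ^ 2 * T ^ 2) := Nat.mul_le_mul hE le_rfl
      have h6 : E * s ^ 2 * k ≤ 2 * n ^ 2 := by omega
      nlinarith
    exact Nat.le_of_mul_le_mul_left h4 (by positivity)
  have hTpos : 1 ≤ T := by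
    by_contra! h
    obtain rfl : T = 0 := by omega
    nlinarith
  obtain ⟨w₁, w₂, k₁, k₂, hk12, h1, h2, h3, h4, h5, h6⟩ := bisect hTpos hkT hw
  have hn2 : 1000 ≤ n := by nlinarith
  obtain ⟨N₁, hN₁, h₁, hb₁⟩ := ih k₁ (by omega) w₁ (by omega) h1
  obtain ⟨N₂, hN₂, h₂, hb₂⟩ := ih k₂ (by omega) w₂ (by omega) h2
  refine ⟨N₁ + N₂, by omega, h6 _ _ _ h₁ h₂, ?_⟩
  rw [mul_add]
  refine (Nat.add_le_add hb₁ hb₂).trans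
    (two_pieces_le (by omega) (by omega) (by omega) hEs hEn)

end

section

open FreeGroup (mk invRev)

variable {α G : Type*} [Group G] {π : FreeGroup α →* G} {s k : ℕ}

/-- The word length on `G` induced by a homomorphism from a free group. -/
noncomputable def wordNorm (π : FreeGroup α →* G) (g : G) : ℕ :=
  sInf {n | ∃ w : List (α × Bool), π (mk w) = g ∧ w.length = n}

lemma wordNorm_le (w : List (α × Bool)) : wordNorm π (π (mk w)) ≤ w.length :=
  Nat.sInf_le ⟨w, rfl, rfl⟩

lemma exists_geodesic (hπ : Function.Surjective π) (g : G) :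
    ∃ w : List (α × Bool), π (mk w) = g ∧ w.length = wordNorm π g := by
  obtain ⟨x, rfl⟩ := hπ g
  obtain ⟨w, rfl⟩ := Quot.exists_rep x
  exact Nat.sInf_mem (s := {n | ∃ v : List (α × Bool), π (mk v) = π (mk w) ∧ v.length = n})
    ⟨_, w, rfl, rfl⟩

/-- The properties of a word length on a group with linear cuts of quadrilaterals which are used
to control its torsion subgroups. -/
structure IsCoarseTree (N : G → ℕ) (n₀ : ℕ) : Prop where
  inv_le : ∀ g, N g⁻¹ ≤ N g
  mul_le : ∀ g h, N (g * h) ≤ N g + N h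
  exists_prefix : ∀ g, ∀ t ≤ N g, ∃ y, N y ≤ t ∧ N (y⁻¹ * g) ≤ N g - t
  finite_ball : ∀ r, {g | N g ≤ r}.Finite
  four_point : ∀ n ≥ n₀, ∀ a b c, N a ≤ 4 * n → N b ≤ 4 * n → N c ≤ 4 * n →
    N (a * b * c) ≤ 4 * n →
    100 * (N (a * b) + N (b * c)) ≤ 100 * (N a + N c) + n ∨
      100 * (N (a * b) + N (b * c)) ≤ 100 * (N b + N (a * b * c)) + n

lemma wordNorm_inv_le (hπ : Function.Surjective π) (g : G) : wordNorm π g⁻¹ ≤ wordNorm π g := by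
  obtain ⟨w, rfl, hw⟩ := exists_geodesic hπ g
  rw [← hw, ← map_inv, FreeGroup.inv_mk, ← FreeGroup.invRev_length (L₁ := w)]
  exact wordNorm_le _

lemma wordNorm_mul_le (hπ : Function.Surjective π) (g h : G) :
    wordNorm π (g * h) ≤ wordNorm π g + wordNorm π h := by
  obtain ⟨w, rfl, hw⟩ := exists_geodesic hπ g
  obtain ⟨v, rfl, hv⟩ := exists_geodesic hπ h
  rw [← hw, ← hv, ← map_mul, ← mk_append, ← List.length_append]
  exact wordNorm_le _

lemma Cut.wordNorm_add_le (hπ : Function.Surjective π) {A₁ A₂ A₃ A₄ : List (α × Bool)} {τ : ℕ}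
    (h : Cut π s k A₁ A₂ A₃ A₄ τ) :
    wordNorm π (π (mk A₁) * π (mk A₂)) + wordNorm π (π (mk A₂) * π (mk A₃)) ≤
      A₁.length + A₃.length + 2 * τ := by
  obtain ⟨a₁, a₂, c₁, c₂, q, k₁, k₂, rfl, rfl, hq, -, h₁, -⟩ := h
  have h2 := h₁.map_eq_one
  simp only [map_mul, map_inv, mul_inv_eq_one] at h2
  have e1 : π (mk (a₁ ++ a₂)) * π (mk A₂) = π (mk a₁) * (π (mk q) * (π (mk c₁))⁻¹) := by
    rw [← h2, mk_append, map_mul]; group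
  have e2 : π (mk A₂) * π (mk (c₁ ++ c₂)) = (π (mk a₂))⁻¹ * (π (mk q) * π (mk c₂)) := by
    rw [← h2, mk_append, map_mul]; group
  rw [e1, e2]
  have l1 := wordNorm_mul_le hπ (π (mk a₁)) (π (mk q) * (π (mk c₁))⁻¹)
  have l2 := wordNorm_mul_le hπ (π (mk q)) (π (mk c₁))⁻¹
  have l3 := wordNorm_mul_le hπ (π (mk a₂))⁻¹ (π (mk q) * π (mk c₂))
  have l4 := wordNorm_mul_le hπ (π (mk q)) (π (mk c₂))
  have m1 := wordNorm_inv_le hπ (π (mk c₁))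
  have m2 := wordNorm_inv_le hπ (π (mk a₂))
  have n1 := wordNorm_le (π := π) a₁
  have n2 := wordNorm_le (π := π) a₂
  have n3 := wordNorm_le (π := π) c₁
  have n4 := wordNorm_le (π := π) c₂
  have n5 := wordNorm_le (π := π) q
  simp only [List.length_append]
  omega

lemma wordNorm_isCoarseTree [Finite α] (hπ : Function.Surjective π) {E : ℕ}
    (hE : E = 81920000) (hs : 1 ≤ s)
    (hA : ∀ w : List (α × Bool), π (mk w) = 1 → ∃ N, HasArea π s N (mk w) ∧
      E * s ^ 2 * N ≤ w.length ^ 2 + 16 * E * s * w.length + E * s ^ 2) :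
    IsCoarseTree (wordNorm π) (1000 * E * s) where
  inv_le := wordNorm_inv_le hπ
  mul_le := wordNorm_mul_le hπ
  exists_prefix g t ht := by
    obtain ⟨w, rfl, hw⟩ := exists_geodesic hπ g
    refine ⟨π (mk (w.take t)), (wordNorm_le _).trans (by simp), ?_⟩
    have : (π (mk (w.take t)))⁻¹ * π (mk w) = π (mk (w.drop t)) := by
      conv_lhs => rw [← List.take_append_drop t w, mk_append, map_mul]
      simp
    rw [this, ← hw]
    exact (wordNorm_le _).trans (by simp)
  finite_ball r := by
    refine ((List.finite_length_le (α × Bool) r).image fun w => π (mk w)).subset fun g hg => ?_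
    obtain ⟨w, rfl, hw⟩ := exists_geodesic hπ g
    exact ⟨w, hw.trans_le hg, rfl⟩
  four_point n hn a b c ha hb hc habc := by
    obtain ⟨A, rfl, hA'⟩ := exists_geodesic hπ a
    obtain ⟨B, rfl, hB'⟩ := exists_geodesic hπ b
    obtain ⟨C, rfl, hC'⟩ := exists_geodesic hπ c
    obtain ⟨D, hD, hD'⟩ := exists_geodesic hπ (π (mk A) * π (mk B) * π (mk C))⁻¹
    have hD2 := wordNorm_inv_le hπ (π (mk A) * π (mk B) * π (mk C))
    obtain ⟨N, hN, hNb⟩ := hA (A ++ B ++ C ++ D) (by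
      simp only [mk_append, map_mul, hD, mul_inv_cancel])
    obtain ⟨T, hT⟩ : ∃ T, T = n / (200 * s) := ⟨_, rfl⟩
    have hT1 : 200 * (s * T) ≤ n := by
      have := Nat.div_mul_le_self n (200 * s); rw [hT]; linarith
    have hn2 : 1000 * (E * s) ≤ n := by linarith
    have hs' : 200 * s ≤ n := by subst hE; omega
    have hT0 : 1 ≤ T := hT ▸ (Nat.one_le_div_iff (by omega)).2 hs'
    have hT2 : n ≤ 400 * (s * T) := by
      have h1 := Nat.lt_div_mul_add (a := n) (b := 200 * s) (by omega)
      rw [← hT] at h1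
      have := Nat.mul_le_mul (le_refl s) hT0
      linarith
    have hlen : (A ++ B ++ C ++ D).length ≤ 16 * n := by
      simp only [List.length_append]; omega
    have hNT : N ≤ T ^ 2 := by
      have h1 : (A ++ B ++ C ++ D).length ^ 2 ≤ 256 * n ^ 2 :=
        (Nat.pow_le_pow_left hlen 2).trans_eq (by ring)
      have h2 := Nat.mul_le_mul (le_refl (16 * E * s)) hlen
      have h3 : 1000 * (E * s * n) ≤ n ^ 2 := by nlinarith
      have h4 : E * s ^ 2 ≤ E * s * n := by
        calc E * s ^ 2 = E * s * s := by ring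
          _ ≤ E * s * n := Nat.mul_le_mul le_rfl (by omega)
      have h5 : E * s ^ 2 * N ≤ 512 * n ^ 2 := by
        have h0 := Nat.zero_le (E * s * n)
        zify at *
        linarith only [h0, h1, h2, h3, h4, hNb]
      have h6 : n ^ 2 ≤ (400 * (s * T)) ^ 2 := Nat.pow_le_pow_left hT2 2
      have h7 : E * s ^ 2 * N ≤ E * s ^ 2 * T ^ 2 := by
        subst hE; linarith
      exact Nat.le_of_mul_le_mul_left h7 (by subst hE; positivity)
    have hsk : s * N / T ≤ s * T := by
      refine Nat.div_le_of_le_mul ?_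
      calc s * N ≤ s * T ^ 2 := Nat.mul_le_mul le_rfl hNT
        _ = T * (s * T) := by ring
    rcases rect hT0 hN with hc | hc
    · have := hc.wordNorm_add_le hπ
      left; omega
    · have h1 := hc.wordNorm_add_le hπ
      have h2 := wordNorm_inv_le hπ (π (mk D) * π (mk A))
      have h3 : (π (mk D) * π (mk A))⁻¹ = π (mk B) * π (mk C) := by rw [hD]; group
      rw [h3] at h2
      right; omega

end

section

variable {G : Type*} [Group G] {N : G → ℕ} {n₀ : ℕ}

namespace IsCoarseTree

lemma inv_eq (hN : IsCoarseTree N n₀) (g : G) : N g⁻¹ = N g :=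
  (hN.inv_le g).antisymm (by simpa using hN.inv_le g⁻¹)

lemma sq_growth (hN : IsCoarseTree N n₀) (h₀ : 1 ≤ n₀) {h : G} (hh : n₀ ≤ N h)
    (h2 : 3 * N h ≤ 2 * N (h * h)) : 3 * N (h * h) ≤ 2 * N (h * h * (h * h)) := by
  have l2 := hN.mul_le h h
  have l3 := hN.mul_le (h * h) h
  have l4 := hN.mul_le (h * h) (h * h)
  have e3 : h * (h * h) = h * h * h := (mul_assoc h h h).symm
  have q3 := hN.four_point (N h) hh h h h (by omega) (by omega) (by omega) (by omega)
  have q4 := hN.four_point (N h) hh h h (h * h) (by omega) (by omega) (by omega) (by omega)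
  rw [e3] at q4
  omega

/-- In a coarse tree, elements whose square is much longer are hyperbolic. -/
lemma not_isOfFinOrder (hN : IsCoarseTree N n₀) (h₀ : 1 ≤ n₀) {h : G} (hh : n₀ ≤ N h)
    (h2 : 3 * N h ≤ 2 * N (h * h)) : ¬ IsOfFinOrder h := by
  have key : ∀ j : ℕ, n₀ + j ≤ N (h ^ 2 ^ j) ∧
      3 * N (h ^ 2 ^ j) ≤ 2 * N (h ^ 2 ^ j * h ^ 2 ^ j) := by
    intro j
    induction j with
    | zero => simpa using ⟨hh, h2⟩
    | succ j ih =>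
      rw [pow_succ 2 j, mul_two, pow_add]
      exact ⟨by omega, hN.sq_growth h₀ (by omega) ih.2⟩
  intro hfin
  obtain ⟨b, hb⟩ := (hfin.finite_powers.image N).bddAbove
  have := hb ⟨h ^ 2 ^ (b + 1), ⟨_, rfl⟩, rfl⟩
  have := (key (b + 1)).1
  omega

/-- A ping-pong argument producing an element of infinite order. -/
lemma exists_not_isOfFinOrder (hN : IsCoarseTree N n₀) (h₀ : 1 ≤ n₀) {f₁ f₂ y : G} {n : ℕ}
    (hn : 1000 ≤ n) (hn₀ : 2 * n₀ ≤ n) (h₁ : N f₁ = n) (h₂ : N f₂ ≤ n)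
    (hy : N y ≤ n / 10) (hy₁ : N (y⁻¹ * f₁) ≤ n - n / 10) (hy₂ : n ≤ N (y⁻¹ * f₂ * y)) :
    ¬ IsOfFinOrder f₁ ∨ ¬ IsOfFinOrder f₂ ∨ ¬ IsOfFinOrder (f₁ * f₂) := by
  by_contra! hfin
  obtain ⟨o₁, o₂, o₃⟩ := hfin
  have ly := hN.mul_le y (y⁻¹ * f₁)
  rw [mul_inv_cancel_left] at ly
  have iy := hN.inv_eq y
  have i₁ := hN.inv_eq f₁
  have i₂ := hN.inv_eq f₂
  have lD := hN.mul_le (y⁻¹ * f₂) y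
  have lP := hN.mul_le y⁻¹ f₂
  have lB : n ≤ N f₂ + 2 * (n / 10) := by omega
  have F₁ : 2 * N (f₁ * f₁) < 3 * N f₁ := by
    by_contra! hc; exact hN.not_isOfFinOrder h₀ (by omega) hc o₁
  have F₂ : 2 * N (f₂ * f₂) < 3 * N f₂ := by
    by_contra! hc; exact hN.not_isOfFinOrder h₀ (by omega) hc o₂
  rw [mul_assoc] at hy₂ lD
  have eF₁ : N (f₁⁻¹ * f₁⁻¹) = N (f₁ * f₁) := by rw [← mul_inv_rev, hN.inv_eq]
  have eF₂ : N (f₂⁻¹ * f₂⁻¹) = N (f₂ * f₂) := by rw [← mul_inv_rev, hN.inv_eq]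
  have eS : N (f₂⁻¹ * f₁) = N (f₁⁻¹ * f₂) := by rw [← hN.inv_eq]; simp
  have eQ : N (f₂ * y) = N (y⁻¹ * f₂⁻¹) := by rw [← hN.inv_eq]; simp
  have l1 := hN.mul_le f₂ y
  have l2 := hN.mul_le f₁⁻¹ f₂
  have l3 := hN.mul_le f₁ f₂
  have l4 := hN.mul_le f₂ f₁
  have l5 := hN.mul_le f₁ (f₂ * f₁)
  have l6 := hN.mul_le (f₁ * f₂) (f₁ * f₂)
  rw [mul_assoc] at l6
  have r1 : 100 * (N f₂ + n) ≤ 100 * (N (y⁻¹ * f₂) + N (y⁻¹ * f₂⁻¹)) + n := by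
    have q := hN.four_point n (by omega) y (y⁻¹ * f₂) y
    simp only [mul_assoc, mul_inv_cancel_left] at q
    specialize q (by omega) (by omega) (by omega) (by omega)
    omega
  have lQ := hN.mul_le y⁻¹ f₂⁻¹
  have r2 : 100 * N (y⁻¹ * f₂⁻¹) ≤ 100 * N (y⁻¹ * f₂) + n := by
    have q := hN.four_point n (by omega) y (y⁻¹ * f₂) (f₂⁻¹ * f₂⁻¹)
    simp only [mul_assoc, mul_inv_cancel_left] at q
    specialize q (by omega) (by omega) (by omega) (by omega)
    omega
  have r3 : 178 * n ≤ 100 * N (f₁⁻¹ * f₂) + 10 := by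
    have q := hN.four_point n (by omega) y (y⁻¹ * f₁) (f₁⁻¹ * f₂)
    simp only [mul_assoc, mul_inv_cancel_left] at q
    specialize q (by omega) (by omega) (by omega) (by omega)
    omega
  have r4 : 100 * N (f₁⁻¹ * f₂) ≤ 100 * N (f₁ * f₂) + n := by
    have q := hN.four_point n (by omega) f₁ (f₁⁻¹ * f₁⁻¹) (f₁ * f₂)
    simp only [mul_assoc, mul_inv_cancel_left, inv_mul_cancel_left] at q
    specialize q (by omega) (by omega) (by omega) (by omega)
    omega
  have r5 : 100 * N (f₁⁻¹ * f₂) ≤ 100 * N (f₂ * f₁) + n := by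
    have q := hN.four_point n (by omega) f₂ (f₂⁻¹ * f₂⁻¹) (f₂ * f₁)
    simp only [mul_assoc, mul_inv_cancel_left, inv_mul_cancel_left] at q
    specialize q (by omega) (by omega) (by omega) (by omega)
    omega
  have r6 : 100 * (N (f₁ * f₂) + N (f₂ * f₁)) ≤ 100 * (N f₂ + N (f₁ * (f₂ * f₁))) + n := by
    have q := hN.four_point n (by omega) f₁ f₂ f₁
    simp only [mul_assoc] at q
    specialize q (by omega) (by omega) (by omega) (by omega)
    omega
  have q := hN.four_point n (by omega) (f₁ * f₂) f₁ f₂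
  simp only [mul_assoc] at q
  specialize q (by omega) (by omega) (by omega) (by omega)
  refine hN.not_isOfFinOrder h₀ (h := f₁ * f₂) (by omega) ?_ o₃
  rw [mul_assoc]
  omega

lemma exists_mem_not_isOfFinOrder (hN : IsCoarseTree N n₀) (h₀ : 1 ≤ n₀) {H : Subgroup G}
    (hH : Infinite H) : ∃ h ∈ H, ¬ IsOfFinOrder h := by
  classical
  by_contra! hfin
  obtain ⟨r, hr⟩ : ∃ r, r = max (2 * n₀) 1000 := ⟨_, rfl⟩
  have hball := hN.finite_ball r
  obtain ⟨F, hFH, hF⟩ :=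
    (Set.infinite_coe_iff.1 hH).exists_subset_card_eq (hball.toFinset.card + 1)
  have hbig : ∀ x : G, ∃ f ∈ F, r < N (x⁻¹ * f * x) := by
    intro x
    by_contra! hc
    have := Finset.card_le_card_of_injOn (t := hball.toFinset) (fun f => x⁻¹ * f * x)
      (fun f hf => by simpa using hc f hf) (fun f _ g _ h => by simpa using h)
    omega
  let M : G → ℕ := fun x => F.sup fun f => N (x⁻¹ * f * x)
  obtain ⟨x, hx⟩ : ∃ x, ∀ z, M x ≤ M z :=
    ⟨Function.argmin M, fun z => Function.argmin_le M z⟩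
  have hle : ∀ z, ∀ f ∈ F, N (z⁻¹ * f * z) ≤ M z := fun z f hf =>
    Finset.le_sup (f := fun f => N (z⁻¹ * f * z)) hf
  obtain ⟨f₀, hf₀, hr₀⟩ := hbig x
  have hmax : ∀ z, ∃ f ∈ F, N (z⁻¹ * f * z) = M z := fun z => by
    obtain ⟨f, hf, h⟩ := F.exists_mem_eq_sup ⟨f₀, hf₀⟩ fun f => N (z⁻¹ * f * z)
    exact ⟨f, hf, h.symm⟩
  have hrM := hle x f₀ hf₀
  obtain ⟨f₁, hf₁, h₁⟩ := hmax x
  obtain ⟨y, hy, hy'⟩ := hN.exists_prefix (x⁻¹ * f₁ * x) (M x / 10) (by omega)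
  obtain ⟨f₂, hf₂, h₂⟩ := hmax (x * y)
  have hconj : ∀ f ∈ H, IsOfFinOrder (x⁻¹ * f * x) := fun f hf => by
    have := (MulAut.conj x⁻¹).toMonoidHom.isOfFinOrder (hfin f hf)
    simpa using this
  have e : x⁻¹ * f₁ * x * (x⁻¹ * f₂ * x) = x⁻¹ * (f₁ * f₂) * x := by group
  rcases hN.exists_not_isOfFinOrder h₀ (n := M x) (by omega) (by omega) h₁ (hle x f₂ hf₂) hy
      (h₁ ▸ hy') ((hx (x * y)).trans (h₂.symm.trans_le (by simp [mul_assoc]))) with h | h | h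
  · exact h (hconj f₁ (hFH hf₁))
  · exact h (hconj f₂ (hFH hf₂))
  · exact h (e ▸ hconj _ (H.mul_mem (hFH hf₁) (hFH hf₂)))

end IsCoarseTree

end

section

open FreeGroup (mk)

variable {α G : Type*} [Group G] {π : FreeGroup α →* G} {s k : ℕ}

lemma HasArea.scale_mono {t : ℕ} {g : FreeGroup α} (hg : HasArea π s k g) (hst : s ≤ t) :
    HasArea π t k g := by
  obtain ⟨w, rfl, hw⟩ := hg
  refine ⟨w, rfl, ?_⟩
  induction hw with
  | nil k => exact .nil k
  | pair e _ _ hu hv => exact .pair e hu hv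
  | cell e r hr he _ h => exact .cell e r (hr.trans_le hst) he h

lemma HasArea.list_prod {l : List (FreeGroup α)} (hl : ∀ g ∈ l, HasArea π s 1 g) :
    HasArea π s l.length l.prod := by
  induction l with
  | nil => exact HasArea.one
  | cons g l ih =>
    rw [List.prod_cons, List.length_cons, Nat.add_comm]
    exact (hl g (by simp)).mul (ih fun x hx => hl x (by simp [hx]))

section Presentation

variable {X : Type} {R : Set (FreeGroup X)}

/-- `w` is a product of `k` conjugates of relators and their inverses. -/
def IsRelatorProduct (R : Set (FreeGroup X)) (w : FreeGroup X) (k : ℕ) : Prop :=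
  ∃ (f r : Fin k → FreeGroup X) (ε : Fin k → ℤ), (∀ i, r i ∈ R) ∧ (∀ i, ε i = 1 ∨ ε i = -1) ∧
    w = (List.ofFn fun i => f i * r i ^ ε i * (f i)⁻¹).prod

lemma IsRelatorProduct.cons {w : FreeGroup X} {k : ℕ} (h : IsRelatorProduct R w k)
    {r : FreeGroup X} (hr : r ∈ R) (c : FreeGroup X) {e : ℤ} (he : e = 1 ∨ e = -1) :
    IsRelatorProduct R (c * r ^ e * c⁻¹ * w) (k + 1) := by
  obtain ⟨f, r', ε, hr', hε, rfl⟩ := h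
  refine ⟨Fin.cons c f, Fin.cons r r', Fin.cons e ε, Fin.cases hr hr', Fin.cases he hε, ?_⟩
  simp [List.ofFn_succ]

lemma exists_isRelatorProduct {w : FreeGroup X} (hw : w ∈ Subgroup.normalClosure R) :
    ∃ k, IsRelatorProduct R w k := by
  induction hw using Subgroup.closure_induction_left with
  | one => exact ⟨0, 1, 1, 1, by simp, by simp, by simp⟩
  | mul_left x hx y _ ih =>
    obtain ⟨k, hk⟩ := ih
    obtain ⟨r, hr, hc⟩ := Group.mem_conjugatesOfSet_iff.1 hx
    obtain ⟨c, rfl⟩ := isConj_iff.1 hc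
    exact ⟨k + 1, by simpa using hk.cons hr c (.inl rfl)⟩
  | inv_mul_cancel x hx y _ ih =>
    obtain ⟨k, hk⟩ := ih
    obtain ⟨r, hr, hc⟩ := Group.mem_conjugatesOfSet_iff.1 hx
    obtain ⟨c, rfl⟩ := isConj_iff.1 hc
    exact ⟨k + 1, by simpa [mul_assoc] using hk.cons hr c (.inr rfl)⟩

lemma mk_eq_one_iff {w : FreeGroup X} :
    PresentedGroup.mk R w = 1 ↔ w ∈ Subgroup.normalClosure R :=
  QuotientGroup.eq_one_iff w

lemma hasArea_presArea {M : ℕ} (hM : ∀ r ∈ R, fgNorm r ≤ M) {w : FreeGroup X}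
    (hw : PresentedGroup.mk R w = 1) :
    HasArea (PresentedGroup.mk R) M (presArea R w) w := by
  classical
  obtain ⟨f, r, ε, hr, hε, h⟩ : IsRelatorProduct R w (presArea R w) :=
    Nat.sInf_mem (exists_isRelatorProduct (mk_eq_one_iff.1 hw))
  have hcell : ∀ r ∈ R, HasArea (PresentedGroup.mk R) M 1 r := fun r hr => by
    let := Classical.decEq X
    have : HasArea (PresentedGroup.mk R) M 1 (mk r.toWord) := by
      refine HasArea.of_short ?_ (hM r hr)
      rw [FreeGroup.mk_toWord, mk_eq_one_iff]
      exact Subgroup.subset_normalClosure hr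
    rwa [FreeGroup.mk_toWord] at this
  have hl := HasArea.list_prod (π := PresentedGroup.mk R) (s := M)
    (l := List.ofFn fun i => f i * r i ^ ε i * (f i)⁻¹) fun g hg => by
      obtain ⟨i, rfl⟩ := List.mem_ofFn.1 hg
      refine HasArea.conj ?_ _
      rcases hε i with h | h <;> rw [h]
      · simpa using hcell _ (hr i)
      · simpa using (hcell _ (hr i)).inv
  rwa [← h, List.length_ofFn] at hl

lemma presArea_le_dehnFunction [Finite X] {w : List (X × Bool)} {L : ℕ} (hL : w.length ≤ L)
    (hw : PresentedGroup.mk R (mk w) = 1) : presArea R (mk w) ≤ dehnFunction R L := by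
  let := Classical.decEq X
  refine le_csSup (Set.Finite.bddAbove (Set.Finite.image _ ?_)) ⟨mk w, ⟨mk_eq_one_iff.1 hw, ?_⟩, rfl⟩
  · refine ((List.finite_length_le (X × Bool) L).image mk).subset fun g hg => ?_
    exact ⟨g.toWord, hg.2, FreeGroup.mk_toWord⟩
  · exact (FreeGroup.norm_mk_le (L₁ := w)).trans hL

lemma exists_isCoarseTree [Finite X] (hR : R.Finite)
    (hdom : ¬ DominatedBy (fun L => L ^ 2) (dehnFunction R)) :
    ∃ n₀, 1 ≤ n₀ ∧ IsCoarseTree (wordNorm (PresentedGroup.mk R)) n₀ := by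
  obtain ⟨E, hE⟩ : ∃ E, E = 81920000 := ⟨_, rfl⟩
  obtain ⟨M₀, hM₀⟩ := (hR.image fgNorm).bddAbove
  obtain ⟨M, hM, hM1⟩ : ∃ M, (∀ r ∈ R, fgNorm r ≤ M) ∧ 1 ≤ M :=
    ⟨M₀ + 1, fun r hr => (hM₀ ⟨r, hr, rfl⟩).trans M₀.le_succ, by omega⟩
  obtain ⟨Q, hQ⟩ : ∃ Q, Q = 32000 * E * M := ⟨_, rfl⟩
  have hQ1 : 1 ≤ Q := by subst hQ hE; omega
  unfold DominatedBy at hdom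
  push Not at hdom
  obtain ⟨L, hL⟩ := hdom (Q ^ 2) (Nat.one_le_pow _ _ hQ1)
  obtain ⟨T, hT⟩ : ∃ T, T = L / Q + 1 := ⟨_, rfl⟩
  have hQL : Q ≤ L := by
    have : Q ^ 2 ≤ L ^ 2 := by omega
    exact (Nat.pow_le_pow_iff_left two_ne_zero).1 this
  have hT1 : 1 ≤ T := hT ▸ Nat.le_add_left _ _
  have hLT : L ≤ Q * T := by
    have := Nat.lt_div_mul_add (a := L) (b := Q) (by omega)
    rw [hT]; linarith
  have hTL : Q * T ≤ 2 * L := by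
    have := Nat.div_mul_le_self L Q
    rw [hT]; linarith
  have hδ : dehnFunction R (Q ^ 2 * L) ≤ T ^ 2 := by
    have h1 : L ^ 2 ≤ (Q * T) ^ 2 := Nat.pow_le_pow_left hLT 2
    rw [mul_pow] at h1
    have h2 : Q ^ 2 * dehnFunction R (Q ^ 2 * L) ≤ Q ^ 2 * T ^ 2 := by omega
    exact Nat.le_of_mul_le_mul_left h2 (pow_pos hQ1 2)
  have hs : 1 ≤ 16 * (M * T) := by
    have := Nat.mul_pos hM1 hT1
    omega
  have hD : 1000 * E * (16 * (M * T)) ≤ Q ^ 2 * L := by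
    have h1 : L ≤ Q ^ 2 * L := Nat.le_mul_of_pos_left _ (pow_pos hQ1 2)
    have h2 : 2 * (1000 * E * (16 * (M * T))) = Q * T := by rw [hQ]; ring
    omega
  have hlow : ∀ w : List (X × Bool), w.length ≤ Q ^ 2 * L → PresentedGroup.mk R (mk w) = 1 →
      ∃ N, HasArea (PresentedGroup.mk R) (16 * (M * T)) N (mk w) ∧
        E * (16 * (M * T)) ^ 2 * N ≤
          w.length ^ 2 + 16 * E * (16 * (M * T)) * w.length + E * (16 * (M * T)) ^ 2 := by
    intro w hw hw1
    obtain ⟨N, hN, hb⟩ := coarsen hM1 hT1 (fun w hw hw1 =>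
      ⟨_, (presArea_le_dehnFunction hw hw1).trans hδ, hasArea_presArea hM hw1⟩) w hw hw1
    refine ⟨N, hN, ?_⟩
    rcases hb with hb | hb
    · have := Nat.mul_le_mul (le_refl (256 * E * (M * T))) hb
      calc _ = 256 * E * (M * T) * (N * (M * T)) := by ring
        _ ≤ _ := this
        _ = E * (16 * (M * T)) ^ 2 := by ring
        _ ≤ _ := Nat.le_add_left _ _
    · have := Nat.mul_le_mul (le_refl (256 * E * (M * T))) (le_of_add_le_left hb)
      calc _ = 256 * E * (M * T) * (N * (M * T)) := by ring
        _ ≤ _ := this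
        _ = 16 * E * (16 * (M * T)) * w.length := by ring
        _ ≤ _ := by omega
  refine ⟨_, ?_, wordNorm_isCoarseTree (PresentedGroup.mk_surjective R) hE hs fun w hw => ?_⟩
  · subst hE; omega
  · have hMs : M ≤ 16 * (M * T) := by
      have := Nat.le_mul_of_pos_right M hT1
      omega
    obtain ⟨N, -, h⟩ := extend (by omega) hs hD hlow _ _ w rfl
      ((hasArea_presArea hM hw).scale_mono hMs)
    exact ⟨N, h⟩

end Presentation

end

end DehnGap

/-- **Optimality.** If the group of a finite presentation `⟨X ∣ R⟩` contains a
finitely generated infinite torsion subgroup, then its Dehn function is at least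
quadratic: `(L ↦ L²) ≼ δ_P`. -/
theorem dehnFunction_at_least_quadratic_of_infinite_torsion_subgroup
    {X : Type} [Fintype X] (R : Set (FreeGroup X)) (hR : R.Finite)
    (H : Subgroup (PresentedGroup R)) (hFG : H.FG) (hInf : Infinite H)
    (hTor : Monoid.IsTorsion H) :
    DominatedBy (fun L => L ^ 2) (dehnFunction R) := by
  by_contra hdom
  obtain ⟨n₀, h₀, hN⟩ := DehnGap.exists_isCoarseTree hR hdom
  obtain ⟨h, hH, hh⟩ := hN.exists_mem_not_isOfFinOrder h₀ hInf
  exact hh (Submonoid.isOfFinOrder_coe.2 (hTor ⟨h, hH⟩))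
end
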